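/- arXiv:1906.03736 — 2 statements merged into one kernel-verified Lean document; each statement's English description precedes it below -/
import Mathlib

section
/- Let K be a subcomplex of I^n and let Γ ⊆ K be a face-like subcomplex. Then the topological space |K| \ |Γ| (with the subspace topology from ℝ^n) is homotopy equivalent to the geometric realization |K ∖ Γ| of the deletion of Γ from K. -/
/-- A face of the cube `I^n`: `none` marks a free coordinate. -/
def CubeFace (n : ℕ) : Type := Fin n → Option Bool

namespace CubeFace

/-- The order on faces of the cube: `F ≤ G` iff every coordinate of `G` is free
or agrees with the corresponding coordinate of `F`. -/
instance (n : ℕ) : PartialOrder (CubeFace n) where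
  le F G := ∀ i, G i = none ∨ F i = G i
  le_refl F i := Or.inr rfl
  le_trans F G H h1 h2 i := by
    rcases h2 i with h | h
    · exact Or.inl h
    · rcases h1 i with h' | h'
      · exact Or.inl (h ▸ h')
      · exact Or.inr (h' ▸ h)
  le_antisymm F G h1 h2 := by
    funext i
    rcases h1 i with h | h
    · rcases h2 i with h' | h'
      · rw [h, h']
      · rw [← h', h]
    · exact h

/-- The face of `I^n` corresponding to a vertex. -/
def toFace {n : ℕ} (v : Fin n → Bool) : CubeFace n := fun i => some (v i)

/-- The vertex set of a face. -/
def verts {n : ℕ} (F : CubeFace n) : Set (Fin n → Bool) := {v | toFace v ≤ F}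

/-- The dimension of a face: its number of free coordinates. -/
def dim {n : ℕ} (F : CubeFace n) : ℕ :=
  haveI : DecidablePred (fun i => F i = none) := fun i => decEq (F i) none
  (Finset.univ.filter (fun i => F i = none)).card

/-- A subcomplex of `I^n`: a nonempty, downward closed set of faces. -/
def IsSubcomplex {n : ℕ} (K : Set (CubeFace n)) : Prop :=
  K.Nonempty ∧ ∀ F ∈ K, ∀ G : CubeFace n, G ≤ F → G ∈ K

/-- The vertex set of a subcomplex. -/
def cvert {n : ℕ} (K : Set (CubeFace n)) : Set (Fin n → Bool) := {v | toFace v ∈ K}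

/-- A subcomplex `Γ ⊆ K` is face-like if, for every face `F` of `K`, the set of vertices
of `F` belonging to `Γ` is empty or the vertex set of a face of `Γ`. -/
def FaceLike {n : ℕ} (K Γ : Set (CubeFace n)) : Prop :=
  ∀ F ∈ K, verts F ∩ cvert Γ = ∅ ∨ ∃ G ∈ Γ, verts F ∩ cvert Γ = verts G

/-- The deletion `K ∖ Γ`: the faces of `K` with no vertex in `Γ`. -/
def delete {n : ℕ} (K Γ : Set (CubeFace n)) : Set (CubeFace n) :=
  {F | F ∈ K ∧ verts F ∩ cvert Γ = ∅}

/-- The geometric realization of a subcomplex of `I^n`, as a subset of `ℝ^n`. -/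
def real {n : ℕ} (K : Set (CubeFace n)) : Set (Fin n → ℝ) :=
  ⋃ F ∈ K, {x | (∀ i, 0 ≤ x i ∧ x i ≤ 1) ∧
    ∀ i, (F i = some false → x i = 0) ∧ (F i = some true → x i = 1)}

/-- The boundary `∂F̂` of a face `F`: all faces strictly below `F`. -/
def bdryHat {n : ℕ} (F : CubeFace n) : Set (CubeFace n) := {G | G ≤ F ∧ G ≠ F}

/-- The boundary of the cube `I^k`: all faces except the top one. -/
def boundaryCube (k : ℕ) : Set (CubeFace k) := {F | F ≠ fun _ => none}

/-- The `k`-skeleton of a subcomplex. -/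
def skel {n : ℕ} (k : ℕ) (K : Set (CubeFace n)) : Set (CubeFace n) :=
  {F | F ∈ K ∧ dim F ≤ k}

/-- Isomorphism of cubical subcomplexes: a bijection between the vertex sets under which
vertex sets of faces correspond to vertex sets of faces. -/
def Iso {m n : ℕ} (K : Set (CubeFace m)) (L : Set (CubeFace n)) : Prop :=
  ∃ f : (Fin m → Bool) → (Fin n → Bool),
    Set.BijOn f (cvert K) (cvert L) ∧
    ∀ W : Set (Fin m → Bool), W ⊆ cvert K →
      ((∃ F ∈ K, verts F = W) ↔ (∃ G ∈ L, verts G = f '' W))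

/-- `K` has dimension `d`. -/
def HasDim {n : ℕ} (K : Set (CubeFace n)) (d : ℕ) : Prop :=
  (∀ F ∈ K, dim F ≤ d) ∧ ∃ F ∈ K, dim F = d

end CubeFace

namespace CubeFace
open Classical in
/-- carrier face of a point -/
noncomputable def supp {n : ℕ} (x : Fin n → ℝ) : CubeFace n := fun i =>
  if x i = 0 then some false else if x i = 1 then some true else none

/-- realization of a single face -/
def cell {n : ℕ} (F : CubeFace n) : Set (Fin n → ℝ) :=
  {x | (∀ i, 0 ≤ x i ∧ x i ≤ 1) ∧
    ∀ i, (F i = some false → x i = 0) ∧ (F i = some true → x i = 1)}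

lemma mem_real {n : ℕ} {K : Set (CubeFace n)} {x : Fin n → ℝ} :
    x ∈ real K ↔ ∃ F ∈ K, x ∈ cell F := by
  simp only [real, Set.mem_iUnion, exists_prop]; rfl

lemma supp_le {n : ℕ} {F : CubeFace n} {x : Fin n → ℝ} (h : x ∈ cell F) : supp x ≤ F := by
  intro i
  have := h.2 i
  rcases hF : F i with _ | _ | _
  · simp
  · right; simp [supp, this.1 hF]
  · right; simp [supp, this.2 hF]

lemma mem_cell_of_supp_le {n : ℕ} {F : CubeFace n} {x : Fin n → ℝ}
    (hx : ∀ i, 0 ≤ x i ∧ x i ≤ 1) (h : supp x ≤ F) : x ∈ cell F := by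
  refine ⟨hx, fun i => ?_⟩
  rcases h i with h | h
  · simp [h]
  · rw [← h]
    by_cases h0 : x i = 0
    · simp [supp, h0]
    · by_cases h1 : x i = 1
      · simp [supp, h1]
      · simp [supp, h0, h1]

lemma supp_mem {n : ℕ} {K : Set (CubeFace n)} (hK : ∀ F ∈ K, ∀ G : CubeFace n, G ≤ F → G ∈ K)
    {x : Fin n → ℝ} (h : x ∈ real K) : supp x ∈ K := by
  obtain ⟨F, hF, hx⟩ := mem_real.1 h
  exact hK F hF _ (supp_le hx)

lemma verts_nonempty {n : ℕ} (F : CubeFace n) : (verts F).Nonempty := by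
  refine ⟨fun i => (F i).getD false, fun i => ?_⟩
  rcases h : F i with _ | b <;> simp [toFace, h]

lemma verts_mono {n : ℕ} {F G : CubeFace n} (h : F ≤ G) : verts F ⊆ verts G :=
  fun _ hv => le_trans hv h

lemma mem_verts {n : ℕ} {F : CubeFace n} {v : Fin n → Bool} :
    v ∈ verts F ↔ ∀ i, F i = none ∨ F i = some (v i) := by
  refine forall_congr' fun i => or_congr Iff.rfl ?_
  exact eq_comm

lemma le_of_verts {n : ℕ} {F G : CubeFace n} (h : verts F ⊆ verts G) : F ≤ G := by
  intro i
  by_contra hc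
  push Not at hc
  obtain ⟨h1, h2⟩ := hc
  obtain ⟨b, hb⟩ := Option.ne_none_iff_exists'.1 h1
  have hFG : F i ≠ some b := by rw [← hb]; exact h2
  -- choose a vertex of F with i-th coordinate different from b
  let v : Fin n → Bool := fun j => (F j).getD (!b)
  have hv : v ∈ verts F := by
    rw [mem_verts]; intro j
    rcases hj : F j with _ | c <;> simp [v, hj]
  have := mem_verts.1 (h hv) i
  rw [hb] at this
  simp only [reduceCtorEq, false_or, Option.some.injEq] at this
  rcases hF : F i with _ | c
  · simp [v, hF] at this
  · simp [v, hF] at this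
    subst this; exact hFG hF

/-- 0/1 value -/
def bval (b : Bool) : ℝ := if b then 1 else 0

/-- displacement from the face -/
def disp {n : ℕ} (G : CubeFace n) (x : Fin n → ℝ) : Fin n → ℝ := fun i =>
  match G i with
  | none => 0
  | some b => x i - bval b

lemma disp_none {n : ℕ} {G : CubeFace n} {x : Fin n → ℝ} {i} (h : G i = none) :
    disp G x i = 0 := by simp [disp, h]

lemma disp_some {n : ℕ} {G : CubeFace n} {x : Fin n → ℝ} {i b} (h : G i = some b) :
    disp G x i = x i - bval b := by simp [disp, h]

lemma cell_eq {n : ℕ} {F : CubeFace n} {x : Fin n → ℝ} (h : x ∈ cell F) {i b}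
    (hi : F i = some b) : x i = bval b := by
  cases b
  · simpa [bval] using (h.2 i).1 hi
  · simpa [bval] using (h.2 i).2 hi

lemma mem_cell {n : ℕ} {F : CubeFace n} {x : Fin n → ℝ}
    (hx : ∀ i, 0 ≤ x i ∧ x i ≤ 1) (h : ∀ i b, F i = some b → x i = bval b) : x ∈ cell F :=
  ⟨hx, fun i => ⟨fun hi => by simpa [bval] using h i _ hi,
    fun hi => by simpa [bval] using h i _ hi⟩⟩

lemma continuous_disp {n : ℕ} (G : CubeFace n) : Continuous (disp G) := by
  refine continuous_pi fun i => ?_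
  rcases h : G i with _ | b
  · simp only [disp_none h]; fun_prop
  · simp only [disp_some h]; fun_prop

lemma isClosed_cell {n : ℕ} (F : CubeFace n) : IsClosed (cell F) := by
  have : cell F = ⋂ i, ({x : Fin n → ℝ | 0 ≤ x i} ∩ {x | x i ≤ 1} ∩
      ({x | F i = some false → x i = 0} ∩ {x | F i = some true → x i = 1})) := by
    ext x
    simp only [cell, Set.mem_setOf_eq, Set.mem_iInter, Set.mem_inter_iff]
    exact forall_and.symm
  rw [this]
  refine isClosed_iInter fun i => ?_
  have hc : Continuous fun x : Fin n → ℝ => x i := continuous_apply i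
  refine ((isClosed_le continuous_const hc).inter (isClosed_le hc continuous_const)).inter
    (IsClosed.inter ?_ ?_)
  · by_cases h : F i = some false
    · simpa [h] using isClosed_eq hc continuous_const
    · simp [h]
  · by_cases h : F i = some true
    · simpa [h] using isClosed_eq hc continuous_const
    · simp [h]

lemma abs_disp_le {n : ℕ} (G : CubeFace n) {x : Fin n → ℝ}
    (hx : ∀ i, 0 ≤ x i ∧ x i ≤ 1) : ‖disp G x‖ ≤ 1 := by
  rw [pi_norm_le_iff_of_nonneg zero_le_one]
  intro i
  have := hx i
  rcases h : G i with _ | b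
  · simp [disp_none h]
  · rw [disp_some h, Real.norm_eq_abs, abs_le]
    cases b <;> simp [bval] <;> constructor <;> linarith

/-- `G` is the trace of `Γ` on `F`. -/
def Tr {n : ℕ} (Γ : Set (CubeFace n)) (F G : CubeFace n) : Prop :=
  G ∈ Γ ∧ verts F ∩ cvert Γ = verts G

open Classical in
/-- the correction term -/
noncomputable def corr {n : ℕ} (Γ : Set (CubeFace n)) (F : CubeFace n) (x : Fin n → ℝ) :
    Fin n → ℝ :=
  if h : ∃ G, Tr Γ F G then (‖disp h.choose x‖⁻¹ - 1) • disp h.choose x else 0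

lemma corr_of_tr {n : ℕ} {Γ : Set (CubeFace n)} {F G : CubeFace n} (h : Tr Γ F G)
    (x : Fin n → ℝ) : corr Γ F x = (‖disp G x‖⁻¹ - 1) • disp G x := by
  have h' : ∃ G, Tr Γ F G := ⟨G, h⟩
  have : h'.choose = G := by
    have h2 := h'.choose_spec
    have e := h2.2.symm.trans h.2
    exact le_antisymm (le_of_verts e.le) (le_of_verts e.ge)
  rw [corr, dif_pos h', this]

lemma corr_of_not {n : ℕ} {Γ : Set (CubeFace n)} {F : CubeFace n} (h : ¬ ∃ G, Tr Γ F G)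
    (x : Fin n → ℝ) : corr Γ F x = 0 := by rw [corr, dif_neg h]

lemma corr_of_empty {n : ℕ} {Γ : Set (CubeFace n)} {F : CubeFace n}
    (h : verts F ∩ cvert Γ = ∅) (x : Fin n → ℝ) : corr Γ F x = 0 := by
  apply corr_of_not
  rintro ⟨G, -, hG⟩
  rw [h] at hG
  exact (verts_nonempty G).ne_empty hG.symm

lemma Tr.le {n : ℕ} {Γ : Set (CubeFace n)} {F G : CubeFace n} (h : Tr Γ F G) : G ≤ F :=
  le_of_verts (h.2 ▸ Set.inter_subset_left)

/-- disjoint faces are separated by a coordinate -/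
lemma exists_sep {n : ℕ} {F G : CubeFace n} (h : verts F ∩ verts G = ∅) :
    ∃ i b, F i = some (!b) ∧ G i = some b := by
  by_contra hc
  push Not at hc
  let v : Fin n → Bool := fun j => (F j).getD ((G j).getD false)
  have : v ∈ verts F ∩ verts G := by
    constructor <;> rw [mem_verts] <;> intro j
    · rcases hj : F j with _ | c <;> simp [v, hj]
    · rcases hG : G j with _ | c
      · simp
      · rcases hj : F j with _ | d
        · simp [v, hj, hG]
        · have h3 : d ≠ !c := fun e => hc j c (e ▸ hj) hG
          right
          simp only [v, hj, Option.getD_some]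
          cases c <;> cases d <;> simp_all
  rw [h] at this
  exact this

lemma corr_compat {n : ℕ} {K Γ : Set (CubeFace n)}
    (hfl : FaceLike K Γ) {F F' : CubeFace n} (hF : F ∈ K) (hF' : F' ∈ K) (hle : F' ≤ F)
    {x : Fin n → ℝ} (hx : x ∈ cell F') : corr Γ F x = corr Γ F' x := by
  have hsub : verts F' ⊆ verts F := verts_mono hle
  rcases hfl F hF with h | ⟨G, hG⟩
  · rw [corr_of_empty h, corr_of_empty]
    rw [Set.eq_empty_iff_forall_notMem] at h ⊢
    exact fun v hv => h v ⟨hsub hv.1, hv.2⟩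
  have hG : Tr Γ F G := hG
  have key : verts F' ∩ cvert Γ = verts F' ∩ verts G := by
    rw [← hG.2]; ext v
    exact ⟨fun hv => ⟨hv.1, hsub hv.1, hv.2⟩, fun hv => ⟨hv.1, hv.2.2⟩⟩
  rw [corr_of_tr hG]
  rcases hfl F' hF' with h | ⟨G', hG'⟩
  · rw [corr_of_empty h]
    rw [key] at h
    obtain ⟨i, b, h1, h2⟩ := exists_sep h
    have h3 : ‖disp G x i‖ = 1 := by
      rw [disp_some h2, cell_eq hx h1]
      cases b <;> simp [bval]
    have h4 : ‖disp G x‖ = 1 :=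
      le_antisymm (abs_disp_le G hx.1) (h3 ▸ norm_le_pi_norm (disp G x) i)
    simp [h4]
  · have hG' : Tr Γ F' G' := hG'
    rw [corr_of_tr hG']
    have e := key.symm.trans hG'.2
    have hle' : G' ≤ G := le_of_verts (e ▸ Set.inter_subset_right)
    suffices disp G x = disp G' x by rw [this]
    funext i
    rcases hi : G i with _ | b
    · rw [disp_none hi]
      rcases hi' : G' i with _ | b
      · rw [disp_none hi']
      · rw [disp_some hi']
        rcases hf : F' i with _ | c
        · exfalso
          obtain ⟨v, hv⟩ := verts_nonempty G'
          have hv' := e ▸ hv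
          have : Function.update v i (!b) ∈ verts G' := by
            rw [← e]
            constructor <;> rw [mem_verts] <;> intro j <;> by_cases hj : j = i
            · subst hj; exact Or.inl hf
            · simpa [hj] using mem_verts.1 hv'.1 j
            · subst hj; exact Or.inl hi
            · simpa [hj] using mem_verts.1 hv'.2 j
          have := mem_verts.1 this i
          simp [hi'] at this
        · rcases hG'.le i with h | h
          · simp [h] at hf
          · rw [cell_eq hx (h ▸ hi')]; simp
    · rcases hle' i with h | h
      · simp [h] at hi
      · rw [disp_some hi, disp_some (h.trans hi)]

/-- a point of a cell in `Γ` lies in the trace -/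
lemma mem_trace {n : ℕ} {Γ : Set (CubeFace n)} (hΓ : IsSubcomplex Γ) {F G : CubeFace n}
    (hG : Tr Γ F G) {x : Fin n → ℝ} (hx : x ∈ cell F) (hxΓ : x ∈ real Γ) : x ∈ cell G := by
  have h1 := supp_mem hΓ.2 hxΓ
  refine mem_cell_of_supp_le hx.1 (le_of_verts ?_)
  rw [← hG.2]
  intro v hv
  exact ⟨verts_mono (supp_le hx) hv, hΓ.2 _ h1 _ hv⟩

lemma disp_eq_zero_iff {n : ℕ} {G : CubeFace n} {x : Fin n → ℝ}
    (hx : ∀ i, 0 ≤ x i ∧ x i ≤ 1) : disp G x = 0 ↔ x ∈ cell G := by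
  constructor
  · intro h
    refine mem_cell hx fun i b hi => ?_
    have := congrFun h i
    rw [disp_some hi] at this
    simpa [sub_eq_zero] using this
  · intro h
    funext i
    rcases hi : G i with _ | b
    · rw [disp_none hi]; rfl
    · rw [disp_some hi, cell_eq h hi]; simp

lemma norm_disp_pos {n : ℕ} {Γ : Set (CubeFace n)} {F G : CubeFace n}
    (hG : Tr Γ F G) {x : Fin n → ℝ} (hx : x ∈ cell F) (hxΓ : x ∉ real Γ) :
    0 < ‖disp G x‖ := by
  rw [norm_pos_iff, Ne, disp_eq_zero_iff hx.1]
  exact fun h => hxΓ (mem_real.2 ⟨G, hG.1, h⟩)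

lemma cell_convex {n : ℕ} {F : CubeFace n} {x c : Fin n → ℝ} (hx : x ∈ cell F)
    (hy : x + c ∈ cell F) {t : ℝ} (h0 : 0 ≤ t) (h1 : t ≤ 1) : x + t • c ∈ cell F := by
  refine mem_cell (fun i => ?_) fun i b hi => ?_
  · have a := hx.1 i
    have b := hy.1 i
    simp only [Pi.add_apply, Pi.smul_apply, smul_eq_mul] at b ⊢
    constructor <;> nlinarith
  · have a := cell_eq hx hi
    have b := cell_eq hy hi
    simp only [Pi.add_apply, Pi.smul_apply, smul_eq_mul] at b ⊢
    have : c i = 0 := by linarith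
    rw [this, a]; simp

lemma retract_cell {n : ℕ} {Γ : Set (CubeFace n)} {F G : CubeFace n}
    (hG : Tr Γ F G) {x : Fin n → ℝ} (hx : x ∈ cell F) (hxΓ : x ∉ real Γ) :
    x + corr Γ F x ∈ cell F := by
  rw [corr_of_tr hG]
  have hM := norm_disp_pos hG hx hxΓ
  set M := ‖disp G x‖ with hMdef
  refine mem_cell (fun i => ?_) fun i b hi => ?_
  · simp only [Pi.add_apply, Pi.smul_apply, smul_eq_mul]
    have hxi := hx.1 i
    rcases hi : G i with _ | b
    · rw [disp_none hi]; simpa using hxi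
    · have h1 : ‖disp G x i‖ ≤ M := norm_le_pi_norm (disp G x) i
      rw [disp_some hi] at h1 ⊢
      have h2 : |M⁻¹ * (x i - bval b)| ≤ 1 := by
        rw [abs_mul, abs_of_pos (inv_pos.2 hM), inv_mul_le_iff₀ hM, mul_one]
        exact h1
      rw [abs_le] at h2
      have h3 : x i + (M⁻¹ - 1) * (x i - bval b) = bval b + M⁻¹ * (x i - bval b) := by ring
      rw [h3]
      have hMi := inv_pos.2 hM
      cases b <;> simp only [bval] at h2 ⊢ <;> norm_num at h2 ⊢
      · exact ⟨mul_nonneg hMi.le hxi.1, h2.2⟩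
      · exact ⟨by linarith, mul_nonpos_of_nonneg_of_nonpos hMi.le (by linarith)⟩
  · have h1 := cell_eq hx hi
    simp only [Pi.add_apply, Pi.smul_apply, smul_eq_mul]
    rcases hG.le i with h | h
    · simp [h] at hi
    · rw [disp_some (h.trans hi), h1]; simp

lemma retract_mem {n : ℕ} {K Γ : Set (CubeFace n)} (hK : IsSubcomplex K)
    (hfl : FaceLike K Γ) {F : CubeFace n} (hF : F ∈ K)
    {x : Fin n → ℝ} (hx : x ∈ cell F) (hxΓ : x ∉ real Γ) :
    x + corr Γ F x ∈ cell F ∧ x + corr Γ F x ∈ real (delete K Γ) := by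
  rcases hfl F hF with h | ⟨G, hG⟩
  · rw [corr_of_empty h, add_zero]
    exact ⟨hx, mem_real.2 ⟨F, ⟨hF, h⟩, hx⟩⟩
  have hG : Tr Γ F G := hG
  have hc := retract_cell hG hx hxΓ
  refine ⟨hc, ?_⟩
  set y := x + corr Γ F x with hy
  have hM := norm_disp_pos hG hx hxΓ
  refine mem_real.2 ⟨supp y, ⟨hK.2 F hF _ (supp_le hc), ?_⟩, mem_cell_of_supp_le hc.1 le_rfl⟩
  have hn : Nonempty (Fin n) := by
    by_contra hne
    rw [not_nonempty_iff] at hne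
    have : disp G x = 0 := Subsingleton.elim _ _
    simp [this] at hM
  obtain ⟨i, hi⟩ : ∃ i, ‖disp G x i‖ = ‖disp G x‖ := by
    obtain ⟨i, hi⟩ := Finite.exists_max fun i => ‖disp G x i‖
    exact ⟨i, le_antisymm (norm_le_pi_norm _ i)
      ((pi_norm_le_iff_of_nonneg (norm_nonneg _)).2 hi)⟩
  rcases hGi : G i with _ | b
  · rw [disp_none hGi] at hi
    rw [← hi] at hM; simp at hM
  have hyi : y i = bval (!b) := by
    rw [hy, corr_of_tr hG]
    simp only [Pi.add_apply, Pi.smul_apply, smul_eq_mul]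
    rw [← hi] at hM ⊢
    rw [disp_some hGi] at hM ⊢
    have hxi := hx.1 i
    rw [Real.norm_eq_abs] at hM ⊢
    cases b
    · simp only [bval, Bool.false_eq_true, if_false, sub_zero, Bool.not_false, if_true] at hM ⊢
      rw [abs_of_nonneg hxi.1] at hM ⊢
      field_simp; ring
    · simp only [bval, Bool.false_eq_true, if_false, Bool.not_true, if_true] at hM ⊢
      have hn : x i - 1 ≤ 0 := by linarith
      rw [abs_of_nonpos hn] at hM ⊢
      have : -(x i - 1) ≠ 0 := hM.ne'
      have e : (-(x i - 1))⁻¹ * (x i - 1) = -1 := by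
        rw [inv_mul_eq_iff_eq_mul₀ this]; ring
      linear_combination e
  have hs : supp y i = some (!b) := by
    cases b <;> simp [supp, hyi, bval]
  rw [Set.eq_empty_iff_forall_notMem]
  rintro v ⟨hv1, hv2⟩
  have hv3 : v ∈ verts G := hG.2 ▸ ⟨verts_mono (supp_le hc) hv1, hv2⟩
  have a := mem_verts.1 hv1 i
  have b' := mem_verts.1 hv3 i
  rw [hs] at a; rw [hGi] at b'
  simp at a b'
  rw [← b'] at a
  cases b <;> simp at a

lemma disp_add {n : ℕ} (G : CubeFace n) (x : Fin n → ℝ) (s : ℝ) :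
    disp G (x + s • disp G x) = (1 + s) • disp G x := by
  funext i
  simp only [Pi.smul_apply, smul_eq_mul]
  rcases hi : G i with _ | b
  · rw [disp_none hi, disp_none hi]; simp
  · rw [disp_some hi]
    simp only [Pi.add_apply, Pi.smul_apply, smul_eq_mul]
    rw [disp_some hi]; ring

lemma homotopy_mem {n : ℕ} {K Γ : Set (CubeFace n)} (hK : IsSubcomplex K)
    (hΓ : IsSubcomplex Γ) (hfl : FaceLike K Γ) {F : CubeFace n} (hF : F ∈ K)
    {x : Fin n → ℝ} (hx : x ∈ cell F) (hxΓ : x ∉ real Γ) {t : ℝ} (h0 : 0 ≤ t) (h1 : t ≤ 1) :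
    x + t • corr Γ F x ∈ real K \ real Γ := by
  have hc := cell_convex hx (retract_mem hK hfl hF hx hxΓ).1 h0 h1
  refine ⟨mem_real.2 ⟨F, hF, hc⟩, fun hmem => ?_⟩
  rcases hfl F hF with h | ⟨G, hG⟩
  · rw [corr_of_empty h] at hmem
    simp at hmem; exact hxΓ hmem
  have hG : Tr Γ F G := hG
  have h2 := mem_trace hΓ hG hc hmem
  rw [← disp_eq_zero_iff hc.1, corr_of_tr hG, smul_smul, disp_add] at h2
  have hM := norm_disp_pos hG hx hxΓ
  have hM1 := abs_disp_le G hx.1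
  have h3 : 1 ≤ ‖disp G x‖⁻¹ := (one_le_inv₀ hM).2 hM1
  rcases smul_eq_zero.1 h2 with h4 | h4
  · nlinarith
  · simp [h4] at hM

lemma continuous_corr {n : ℕ} {K Γ : Set (CubeFace n)} (hK : IsSubcomplex K)
    (hfl : FaceLike K Γ) :
    Continuous fun x : ↥(real K \ real Γ) => corr Γ (supp x.1) x.1 := by
  haveI : Finite (CubeFace n) := inferInstanceAs (Finite (Fin n → Option Bool))
  let S : K → Set ↥(real K \ real Γ) := fun F => {x | x.1 ∈ cell F.1}
  refine (locallyFinite_of_finite S).continuous ?_ ?_ ?_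
  · rw [Set.eq_univ_iff_forall]
    intro x
    obtain ⟨F, hF, hx⟩ := mem_real.1 x.2.1
    exact Set.mem_iUnion.2 ⟨⟨F, hF⟩, hx⟩
  · exact fun F => (isClosed_cell F.1).preimage continuous_subtype_val
  · rintro ⟨F, hF⟩
    have hcongr : Set.EqOn (fun x : ↥(real K \ real Γ) => corr Γ (supp x.1) x.1)
        (fun x => corr Γ F x.1) (S ⟨F, hF⟩) := by
      intro x hx
      have hx : x.1 ∈ cell F := hx
      exact (corr_compat hfl hF (hK.2 F hF _ (supp_le hx)) (supp_le hx)
        (mem_cell_of_supp_le hx.1 le_rfl)).symm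
    refine ContinuousOn.congr ?_ hcongr
    by_cases h : ∃ G, Tr Γ F G
    · obtain ⟨G, hG⟩ := h
      simp only [corr_of_tr hG]
      have hd : Continuous fun x : ↥(real K \ real Γ) => disp G x.1 :=
        (continuous_disp G).comp continuous_subtype_val
      refine ContinuousOn.smul (ContinuousOn.sub (ContinuousOn.inv₀ hd.norm.continuousOn ?_)
        continuousOn_const) hd.continuousOn
      intro x hx
      exact (norm_disp_pos hG hx x.2.2).ne'
    · simp only [corr_of_not h]
      exact continuousOn_const

lemma delete_sub {n : ℕ} {K Γ : Set (CubeFace n)} (hK : IsSubcomplex K)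
    (hΓ : IsSubcomplex Γ) {x : Fin n → ℝ} (hx : x ∈ real (delete K Γ)) :
    x ∈ real K \ real Γ ∧ verts (supp x) ∩ cvert Γ = ∅ := by
  obtain ⟨F, hF, hxF⟩ := mem_real.1 hx
  have h : verts (supp x) ∩ cvert Γ = ∅ := by
    rw [← Set.subset_empty_iff, ← hF.2]
    exact Set.inter_subset_inter_left _ (verts_mono (supp_le hxF))
  refine ⟨⟨mem_real.2 ⟨F, hF.1, hxF⟩, fun hG => ?_⟩, h⟩
  obtain ⟨v, hv⟩ := verts_nonempty (supp x)
  have : v ∈ verts (supp x) ∩ cvert Γ := ⟨hv, hΓ.2 _ (supp_mem hΓ.2 hG) _ hv⟩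
  rw [h] at this; exact this

lemma mem_supp_cell {n : ℕ} {K : Set (CubeFace n)} {x : Fin n → ℝ} (hx : x ∈ real K) :
    x ∈ cell (supp x) := by
  obtain ⟨F, -, h⟩ := mem_real.1 hx
  exact mem_cell_of_supp_le h.1 le_rfl

end CubeFace

open CubeFace in
/-- if `Γ` is a face-like subcomplex of a subcomplex `K` of `I^n`, then
`|K| \ |Γ|` is homotopy equivalent to `|K ∖ Γ|`. -/
theorem realization_minus_facelike_homotopyEquiv_deletion
    {n : ℕ} (K Γ : Set (CubeFace n))
    (hK : IsSubcomplex K) (hΓ : IsSubcomplex Γ) (hΓK : Γ ⊆ K)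
    (hfl : FaceLike K Γ) :
    Nonempty (ContinuousMap.HomotopyEquiv (↥(real K \ real Γ)) (↥(real (delete K Γ)))) := by
  have hc := continuous_corr hK hfl
  let r : C(↥(real K \ real Γ), ↥(real (delete K Γ))) :=
    ⟨fun x => ⟨x.1 + corr Γ (supp x.1) x.1,
      (retract_mem hK hfl (supp_mem hK.2 x.2.1) (mem_supp_cell x.2.1) x.2.2).2⟩,
      (continuous_subtype_val.add hc).subtype_mk _⟩
  let ι : C(↥(real (delete K Γ)), ↥(real K \ real Γ)) :=
    ⟨fun x => ⟨x.1, (delete_sub hK hΓ x.2).1⟩, continuous_subtype_val.subtype_mk _⟩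
  let H : ContinuousMap.Homotopy (ContinuousMap.id _) (ι.comp r) :=
    { toFun := fun p => ⟨p.2.1 + (p.1 : ℝ) • corr Γ (supp p.2.1) p.2.1,
        homotopy_mem hK hΓ hfl (supp_mem hK.2 p.2.2.1) (mem_supp_cell p.2.2.1) p.2.2.2
          p.1.2.1 p.1.2.2⟩
      continuous_toFun := by
        refine Continuous.subtype_mk ?_ _
        exact (continuous_subtype_val.comp continuous_snd).add
          ((continuous_subtype_val.comp continuous_fst).smul (hc.comp continuous_snd))
      map_zero_left := fun x => by apply Subtype.ext; simp
      map_one_left := fun x => by apply Subtype.ext; simp [r, ι] }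
  have hri : r.comp ι = ContinuousMap.id _ := by
    ext1 x
    apply Subtype.ext
    change x.1 + corr Γ (supp x.1) x.1 = x.1
    rw [corr_of_empty (delete_sub hK hΓ x.2).2, add_zero]
  exact ⟨⟨r, ι, ⟨H.symm⟩, hri ▸ ContinuousMap.Homotopic.refl _⟩⟩
end

section
/- Let M be a subcomplex of I^n of dimension d whose geometric realization |M| is a compact topological d-manifold without boundary (in particular a ℤ/2-homology d-manifold, the paper's hypothesis), let k ≥ 2, and let S ⊆ M be a subcomplex isomorphic to ∂I^{k+1}. If S is the boundary of a face of M, i.e. S = ∂F̂ for some (k+1)-dimensional face F ∈ M, then H_j(|M ∖ S|; ℤ/2) ≅ H_j(|M|; ℤ/2) for all j ≤ d − 2. -/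
open CategoryTheory in
/-- The `j`-th singular homology of a topological space with coefficients in `R`. -/
noncomputable def sHomology (R : Type) [CommRing R] (X : Type) [TopologicalSpace X]
    (j : ℕ) : ModuleCat R :=
  ((AlgebraicTopology.alternatingFaceMapComplex (ModuleCat R)).obj
    (((SimplicialObject.whiskering _ _).obj (ModuleCat.free R)).obj
      (TopCat.toSSet.obj (TopCat.of X)))).homology j

/-- `X` is a compact topological `d`-manifold without boundary. -/
def IsCompactManifold (X : Type) [TopologicalSpace X] (d : ℕ) : Prop :=
  CompactSpace X ∧ Nonempty (ChartedSpace (EuclideanSpace ℝ (Fin d)) X)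


namespace CubeDel
open Finsupp

/-! ### Tuple chains -/

abbrev R := ZMod 2

/-- Formal chains on tuples of points. -/
abbrev T (K : Type) (m : ℕ) := (Fin m → K) →₀ R

/-- The boundary of a chain of tuples. -/
noncomputable def tbd {K : Type} {m : ℕ} : T K (m + 1) →ₗ[R] T K m :=
  ∑ i : Fin (m + 1), (-1 : ℤ) ^ (i : ℕ) • lmapDomain R R (fun p => p ∘ i.succAbove)

/-- The cone of a chain of tuples. -/
noncomputable def cone {K : Type} {m : ℕ} (b : K) : T K m →ₗ[R] T K (m + 1) :=
  lmapDomain R R (fun p => (Fin.cons b p : Fin (m + 1) → K))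

/-- Push forward of tuples. -/
noncomputable def tmap {K L : Type} {m : ℕ} (h : K → L) : T K m →ₗ[R] T L m :=
  lmapDomain R R (fun p => h ∘ p)

theorem tbd_single {K : Type} {m : ℕ} (p : Fin (m + 1) → K) :
    tbd (single p (1 : R)) =
      ∑ i : Fin (m + 1), (-1 : ℤ) ^ (i : ℕ) • single (p ∘ i.succAbove) (1 : R) := by
  simp [tbd, LinearMap.sum_apply]

@[simp] theorem cone_single {K : Type} {m : ℕ} (b : K) (p : Fin m → K) :
    cone b (single p (1 : R)) = single (Fin.cons b p : Fin (m + 1) → K) (1 : R) := by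
  simp [cone]

@[simp] theorem tmap_single {K L : Type} {m : ℕ} (h : K → L) (p : Fin m → K) :
    tmap h (single p (1 : R)) = single (h ∘ p) (1 : R) := by
  simp [tmap]

theorem lext {X N : Type} [AddCommGroup N] [Module R N] {f g : (X →₀ R) →ₗ[R] N}
    (h : ∀ x, f (single x 1) = g (single x 1)) (x : X →₀ R) : f x = g x := by
  have : f = g := by
    apply Finsupp.lhom_ext'
    intro a
    apply LinearMap.ext_ring
    simpa using h a
  rw [this]

theorem tbd_tmap {K L : Type} {m : ℕ} (h : K → L) (x : T K (m + 1)) :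
    tbd (tmap h x) = tmap h (tbd x) := by
  refine lext (f := tbd ∘ₗ tmap h) (g := tmap h ∘ₗ tbd) (fun p => ?_) x
  simp [tbd_single, Function.comp_assoc]

theorem tmap_cone {K L : Type} {m : ℕ} (h : K → L) (b : K) (x : T K m) :
    tmap h (cone b x) = cone (h b) (tmap h x) := by
  refine lext (f := tmap h ∘ₗ cone b) (g := cone (h b) ∘ₗ tmap h) (fun p => ?_) x
  simp only [LinearMap.comp_apply, cone_single, tmap_single]
  congr 1
  funext i
  refine Fin.cases ?_ (fun j => ?_) i <;> simp

theorem tbd_cone_zero {K : Type} (b : K) (x : T K 0) : tbd (cone b x) = x := by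
  refine lext (f := tbd ∘ₗ cone b) (g := LinearMap.id) (fun p => ?_) x
  simp only [LinearMap.comp_apply, cone_single, tbd_single, LinearMap.id_apply]
  rw [Fin.sum_univ_succ]
  simp only [Finset.univ_eq_empty, Finset.sum_empty, Fin.val_zero, pow_zero, one_smul, add_zero]
  congr 1

theorem tbd_cone {K : Type} {m : ℕ} (b : K) (x : T K (m + 1)) :
    tbd (cone b x) = x - cone b (tbd x) := by
  refine lext (f := tbd ∘ₗ cone b) (g := LinearMap.id - cone b ∘ₗ tbd) (fun p => ?_) x
  simp only [LinearMap.comp_apply, cone_single, tbd_single, LinearMap.sub_apply,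
    LinearMap.id_apply, map_sum, map_zsmul]
  rw [Fin.sum_univ_succ, sub_eq_add_neg, ← Finset.sum_neg_distrib]
  congr 1
  · simp only [Fin.val_zero, pow_zero, one_smul]
    congr 1
  · refine Finset.sum_congr rfl fun i _ => ?_
    rw [Fin.val_succ, pow_succ, mul_neg_one, neg_smul]
    congr 3
    funext j
    refine Fin.cases ?_ (fun j => ?_) j <;> simp

theorem tbd_tbd {K : Type} {m : ℕ} (x : T K (m + 2)) : tbd (tbd x) = 0 := by
  induction m with
  | zero =>
    refine lext (f := tbd ∘ₗ tbd) (g := 0) (fun p => ?_) x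
    rw [← Fin.cons_self_tail p, ← cone_single]
    simp only [LinearMap.comp_apply, tbd_cone, map_sub, tbd_cone_zero, sub_self,
      LinearMap.zero_apply]
  | succ m ih =>
    refine lext (f := tbd ∘ₗ tbd) (g := 0) (fun p => ?_) x
    rw [← Fin.cons_self_tail p, ← cone_single]
    simp only [LinearMap.comp_apply, tbd_cone, map_sub, ih, sub_self,
      LinearMap.zero_apply, map_zero, sub_zero]

/-- Generic chain homotopy obtained by coning. -/
noncomputable def hom {K K' : Type} (f g : ∀ m, T K m →ₗ[R] T K' m)
    (b : ∀ m, (Fin (m + 1) → K) → K') : ∀ m, T K m →ₗ[R] T K' (m + 1)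
  | 0 => 0
  | m + 1 => linearCombination R (fun p => cone (b m p)
      (f (m + 1) (single p 1) - g (m + 1) (single p 1) - hom f g b m (tbd (single p 1))))

theorem hom_single {K K' : Type} (f g : ∀ m, T K m →ₗ[R] T K' m)
    (b : ∀ m, (Fin (m + 1) → K) → K') (m : ℕ) (p : Fin (m + 1) → K) :
    hom f g b (m + 1) (single p 1) = cone (b m p)
      (f (m + 1) (single p 1) - g (m + 1) (single p 1) - hom f g b m (tbd (single p 1))) := by
  rw [hom, linearCombination_single, one_smul]

theorem hom_spec {K K' : Type} (f g : ∀ m, T K m →ₗ[R] T K' m)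
    (b : ∀ m, (Fin (m + 1) → K) → K')
    (hf : ∀ m x, tbd (f (m + 1) x) = f m (tbd x))
    (hg : ∀ m x, tbd (g (m + 1) x) = g m (tbd x)) (h0 : f 0 = g 0) (m : ℕ) (x : T K (m + 1)) :
    tbd (hom f g b (m + 1) x) = f (m + 1) x - g (m + 1) x - hom f g b m (tbd x) := by
  induction m with
  | zero =>
    refine lext (f := tbd ∘ₗ hom f g b 1)
      (g := f 1 - g 1 - hom f g b 0 ∘ₗ tbd) (fun p => ?_) x
    simp only [LinearMap.comp_apply, LinearMap.sub_apply]
    rw [hom_single, tbd_cone]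
    simp only [map_sub, hf, hg, h0, hom, LinearMap.zero_apply, map_zero, sub_self, sub_zero]
  | succ m ih =>
    refine lext (f := tbd ∘ₗ hom f g b (m + 2))
      (g := f (m + 2) - g (m + 2) - hom f g b (m + 1) ∘ₗ tbd) (fun p => ?_) x
    simp only [LinearMap.comp_apply, LinearMap.sub_apply]
    rw [hom_single, tbd_cone]
    simp only [map_sub, hf, hg, ih, tbd_tbd, map_zero, sub_self, sub_zero]

theorem hom_nat {K K' L L' : Type} (f g : ∀ m, T K m →ₗ[R] T K' m)
    (b : ∀ m, (Fin (m + 1) → K) → K') (f' g' : ∀ m, T L m →ₗ[R] T L' m)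
    (b' : ∀ m, (Fin (m + 1) → L) → L') (h : K → L) (h' : K' → L')
    (hf : ∀ m x, tmap h' (f m x) = f' m (tmap h x))
    (hg : ∀ m x, tmap h' (g m x) = g' m (tmap h x))
    (hb : ∀ m p, h' (b m p) = b' m (h ∘ p)) (m : ℕ) (x : T K m) :
    tmap h' (hom f g b m x) = hom f' g' b' m (tmap h x) := by
  induction m with
  | zero => simp [hom]
  | succ m ih =>
    refine lext (f := tmap h' ∘ₗ hom f g b (m + 1)) (g := hom f' g' b' (m + 1) ∘ₗ tmap h)
      (fun p => ?_) x
    simp only [LinearMap.comp_apply]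
    rw [tmap_single, hom_single, hom_single, tmap_cone, hb]
    congr 1
    rw [map_sub, map_sub, hf, hg, ih, ← tbd_tmap, tmap_single]

/-! ### Convex types -/

abbrev Δ (m : ℕ) := stdSimplex ℝ (Fin m)

/-- A type with convex combinations, realised inside a real vector space. -/
class Cv (K : Type) (E : outParam Type) [AddCommGroup E] [Module ℝ E] where
  emb : K → E
  inj : Function.Injective emb
  comb : ∀ {m : ℕ}, (Fin m → K) → Δ m → K
  emb_comb : ∀ {m : ℕ} (q : Fin m → K) (x : Δ m), emb (comb q x) = ∑ i, x i • emb (q i)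

section
variable {K E : Type} [AddCommGroup E] [Module ℝ E] [Cv K E]
variable {L F : Type} [AddCommGroup F] [Module ℝ F] [Cv L F]

/-- Convex combinations. -/
def comb {K E : Type} [AddCommGroup E] [Module ℝ E] [Cv K E] {m : ℕ}
    (q : Fin m → K) (x : Δ m) : K := Cv.comb q x

theorem emb_comb {m : ℕ} (q : Fin m → K) (x : Δ m) :
    (Cv.emb (comb q x) : E) = ∑ i, x i • Cv.emb (q i) := Cv.emb_comb q x

/-- Affine maps. -/
def Aff (h : K → L) : Prop := ∀ (m : ℕ) (q : Fin m → K) (x : Δ m), h (comb q x) = comb (h ∘ q) x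

noncomputable instance instCvΔ (n : ℕ) : Cv (Δ n) (Fin n → ℝ) where
  emb x := x.1
  inj := Subtype.val_injective
  comb q x := ⟨∑ i, x i • (q i).1, (convex_stdSimplex ℝ (Fin n)).sum_mem
    (fun i _ => x.2.1 i) x.2.2 (fun i _ => (q i).2)⟩
  emb_comb _ _ := rfl

noncomputable instance instCvI : Cv (Set.Icc (0 : ℝ) 1) ℝ where
  emb x := x.1
  inj := Subtype.val_injective
  comb q x := ⟨∑ i, x i • (q i).1, (convex_Icc (0 : ℝ) 1).sum_mem
    (fun i _ => x.2.1 i) x.2.2 (fun i _ => (q i).2)⟩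
  emb_comb _ _ := rfl

noncomputable instance instCvProd : Cv (K × L) (E × F) where
  emb x := (Cv.emb x.1, Cv.emb x.2)
  inj x y h := Prod.ext (Cv.inj (congrArg Prod.fst h)) (Cv.inj (congrArg Prod.snd h))
  comb q x := (comb (fun i => (q i).1) x, comb (fun i => (q i).2) x)
  emb_comb q x := by
    refine Prod.ext ?_ ?_
    · simp [emb_comb, Prod.fst_sum]
    · simp [emb_comb, Prod.snd_sum]

theorem comb_prod {m : ℕ} (q : Fin m → K × L) (x : Δ m) :
    comb q x = (comb (fun i => (q i).1) x, comb (fun i => (q i).2) x) := rfl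

theorem comb_map {m k : ℕ} (q : Fin m → K) (s : Fin k → Fin m) (x : Δ k) :
    comb q (stdSimplex.map s x) = comb (q ∘ s) x := by
  apply Cv.inj (E := E)
  rw [emb_comb, emb_comb]
  have : ∀ i, stdSimplex.map s x i = ∑ j, if s j = i then x j else 0 := by
    intro i
    have := congrFun (stdSimplex.map_coe (S := ℝ) s x) i
    rw [FunOnFinite.linearMap_apply_apply] at this
    rw [← Finset.sum_filter]
    exact this
  simp only [this, Finset.sum_smul, ite_smul, zero_smul]
  rw [Finset.sum_comm]
  simp

theorem comb_vertex {m : ℕ} (q : Fin m → K) (i : Fin m) : comb q (stdSimplex.vertex i) = q i := by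
  apply Cv.inj (E := E)
  rw [emb_comb, Finset.sum_eq_single i]
  · have : (stdSimplex.vertex (S := ℝ) i) i = 1 := by
      show (stdSimplex.vertex (S := ℝ) i).1 i = 1
      simp
    rw [this, one_smul]
  · intro j _ hj
    have : (stdSimplex.vertex (S := ℝ) i) j = 0 := by
      show (stdSimplex.vertex (S := ℝ) i).1 j = 0
      simp [hj]
    rw [this, zero_smul]
  · simp

/-- The tuple of vertices. -/
noncomputable def iot (m : ℕ) : Fin m → Δ m := fun i => stdSimplex.vertex i

theorem comb_iot {m : ℕ} (x : Δ m) : comb (iot m) x = x := by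
  apply Subtype.ext
  have := emb_comb (iot m) x
  refine this.trans ?_
  funext j
  rw [Finset.sum_apply, Finset.sum_eq_single j]
  · show x j * (stdSimplex.vertex (S := ℝ) j).1 j = _
    simp
    rfl
  · intro i _ hi
    show x i * (stdSimplex.vertex (S := ℝ) i).1 j = _
    simp [hi.symm]
  · simp

theorem aff_comb {m : ℕ} (q : Fin m → K) : Aff (comb q : Δ m → K) := by
  intro k r x
  apply Cv.inj (E := E)
  rw [emb_comb, emb_comb]
  have h1 : ∀ i, (comb r x) i = ∑ j, x j * (r j) i := by
    intro i
    have := congrFun (emb_comb r x) i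
    rw [Finset.sum_apply] at this
    exact this
  simp only [Function.comp, emb_comb, h1, Finset.sum_smul, Finset.smul_sum, mul_smul]
  rw [Finset.sum_comm]

theorem aff_map {m k : ℕ} (s : Fin k → Fin m) :
    Aff (stdSimplex.map s : Δ k → Δ m) := by
  have : (stdSimplex.map s : Δ k → Δ m) = comb (iot m ∘ s) := by
    funext x
    rw [← comb_map, comb_iot]
  rw [this]
  exact aff_comb _

theorem comb_iot_comp {m : ℕ} (q : Fin m → K) : comb q ∘ iot m = q := by
  funext i
  exact comb_vertex q i

theorem map_iot {m k : ℕ} (s : Fin k → Fin m) :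
    (stdSimplex.map s : Δ k → Δ m) ∘ iot k = iot m ∘ s := by
  funext i
  simp [iot]

/-! ### Subdivision of tuples -/

/-- Barycenter. -/
noncomputable def bary (m : ℕ) (p : Fin (m + 1) → K) : K := comb p stdSimplex.barycenter

theorem Aff.bary {h : K → L} (hh : Aff h) (m : ℕ) (p : Fin (m + 1) → K) :
    h (bary m p) = CubeDel.bary m (h ∘ p) := hh _ _ _

/-- Barycentric subdivision. -/
noncomputable def sd {K E : Type} [AddCommGroup E] [Module ℝ E] [Cv K E] :
    ∀ m, T K m →ₗ[R] T K m
  | 0 => LinearMap.id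
  | m + 1 => linearCombination R (fun p => cone (bary m p) (sd m (tbd (single p 1))))

theorem sd_zero : sd (K := K) 0 = LinearMap.id := by
  rw [sd]

theorem sd_single (m : ℕ) (p : Fin (m + 1) → K) :
    sd (m + 1) (single p 1) = cone (bary m p) (sd m (tbd (single p 1))) := by
  rw [sd, linearCombination_single, one_smul]

theorem tbd_sd (m : ℕ) (x : T K (m + 1)) : tbd (sd (m + 1) x) = sd m (tbd x) := by
  induction m with
  | zero =>
    refine lext (f := tbd ∘ₗ sd (K := K) 1) (g := sd (K := K) 0 ∘ₗ tbd) (fun p => ?_) x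
    simp only [LinearMap.comp_apply]
    rw [sd_single, tbd_cone_zero]
  | succ m ih =>
    refine lext (f := tbd ∘ₗ sd (K := K) (m + 2)) (g := sd (K := K) (m + 1) ∘ₗ tbd) (fun p => ?_) x
    simp only [LinearMap.comp_apply]
    rw [sd_single, tbd_cone, ih, tbd_tbd, map_zero, map_zero, sub_zero]

theorem sd_nat {h : K → L} (hh : Aff h) (m : ℕ) (x : T K m) :
    tmap h (sd m x) = sd m (tmap h x) := by
  induction m with
  | zero => simp [sd]
  | succ m ih =>
    refine lext (f := tmap h ∘ₗ sd (m + 1)) (g := sd (m + 1) ∘ₗ tmap h) (fun p => ?_) x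
    simp only [LinearMap.comp_apply]
    rw [sd_single, tmap_cone, hh.bary, ih, ← tbd_tmap, tmap_single, sd_single]

/-- The homotopy between the identity and subdivision. -/
noncomputable def sdh (K : Type) {E : Type} [AddCommGroup E] [Module ℝ E] [Cv K E] (m : ℕ) :
    T K m →ₗ[R] T K (m + 1) :=
  hom (fun _ => LinearMap.id) (fun m => sd m) (fun m => bary m) m

theorem sdh_spec (m : ℕ) (x : T K (m + 1)) :
    tbd (sdh K (m + 1) x) = x - sd (m + 1) x - sdh K m (tbd x) := by
  unfold sdh
  refine hom_spec (K := K) (K' := K) (fun _ => LinearMap.id) (fun m => sd m)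
    (fun m => bary m) ?_ ?_ ?_ m x
  · intro m x
    rfl
  · intro m x
    exact tbd_sd m x
  · exact sd_zero.symm

theorem sdh_nat {h : K → L} (hh : Aff h) (m : ℕ) (x : T K m) :
    tmap h (sdh K m x) = sdh L m (tmap h x) := by
  unfold sdh
  refine hom_nat (K := K) (K' := K) (L := L) (L' := L) (fun _ => LinearMap.id) (fun m => sd m)
    (fun m => bary m) (fun _ => LinearMap.id) (fun m => sd m) (fun m => bary m) h h
    ?_ ?_ ?_ m x
  · intro m x
    rfl
  · intro m x
    exact sd_nat hh m x
  · intro m p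
    exact hh.bary m p

/-- The prism operator. -/
noncomputable def pr (K : Type) (m : ℕ) : T K m →ₗ[R] T (K × Set.Icc (0 : ℝ) 1) (m + 1) :=
  hom (fun _ => tmap (fun x => (x, (1 : Set.Icc (0 : ℝ) 1))))
    (fun _ => tmap (fun x => (x, (0 : Set.Icc (0 : ℝ) 1))))
    (fun _ p => (p 0, 0)) m

theorem pr_spec {K : Type} (m : ℕ) (x : T K (m + 1)) :
    tbd (pr K (m + 1) x) = tmap (fun x => (x, (1 : Set.Icc (0 : ℝ) 1))) x
      - tmap (fun x => (x, (0 : Set.Icc (0 : ℝ) 1))) x - pr K m (tbd x) := by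
  refine hom_spec _ _ _ (fun _ _ => tbd_tmap _ _) (fun _ _ => tbd_tmap _ _) ?_ m x
  refine LinearMap.ext fun x => lext (fun p => ?_) x
  simp only [tmap_single]
  congr 1
  exact Subsingleton.elim _ _

theorem tmap_tmap_eq {K L L' N : Type} {m : ℕ} (f : K → L) (g : L → N) (f' : K → L') (g' : L' → N)
    (h : g ∘ f = g' ∘ f') (x : T K m) : tmap g (tmap f x) = tmap g' (tmap f' x) := by
  refine lext (f := tmap g ∘ₗ tmap f) (g := tmap g' ∘ₗ tmap f') (fun p => ?_) x
  simp only [LinearMap.comp_apply, tmap_single, ← Function.comp_assoc, h]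

theorem pr_nat {K L : Type} {h : K → L} (m : ℕ) (x : T K m) :
    tmap (fun y : K × Set.Icc (0 : ℝ) 1 => (h y.1, y.2)) (pr K m x) = pr L m (tmap h x) := by
  unfold pr
  refine hom_nat (K := K) (L := L) (fun _ => tmap (fun x => (x, (1 : Set.Icc (0 : ℝ) 1))))
    (fun _ => tmap (fun x => (x, (0 : Set.Icc (0 : ℝ) 1))))
    (fun _ p => (p 0, 0)) (fun _ => tmap (fun x => (x, (1 : Set.Icc (0 : ℝ) 1))))
    (fun _ => tmap (fun x => (x, (0 : Set.Icc (0 : ℝ) 1))))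
    (fun _ p => (p 0, 0)) h (fun y : K × Set.Icc (0 : ℝ) 1 => (h y.1, y.2)) ?_ ?_ ?_ m x
  · intro m x
    apply tmap_tmap_eq
    rfl
  · intro m x
    apply tmap_tmap_eq
    rfl
  · intro m p
    rfl

end
end CubeDel

namespace CubeDel
open Finsupp
/-! ### Singular chains (spanned by arbitrary functions on simplices) -/

/-- Chains of functions on the simplex with `m` vertices. -/
abbrev S (V : Type) (m : ℕ) := (Δ m → V) →₀ R

/-- The boundary. -/
noncomputable def sbd {V : Type} {m : ℕ} : S V (m + 1) →ₗ[R] S V m :=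
  ∑ i : Fin (m + 1), (-1 : ℤ) ^ (i : ℕ) • lmapDomain R R (fun σ => σ ∘ stdSimplex.map i.succAbove)

/-- Push forward. -/
noncomputable def smap {V W : Type} {m : ℕ} (g : V → W) : S V m →ₗ[R] S W m :=
  lmapDomain R R (fun σ => g ∘ σ)

theorem sbd_single {V : Type} {m : ℕ} (σ : Δ (m + 1) → V) :
    sbd (single σ (1 : R)) = ∑ i : Fin (m + 1), (-1 : ℤ) ^ (i : ℕ) •
      single (σ ∘ stdSimplex.map i.succAbove) (1 : R) := by
  simp [sbd, LinearMap.sum_apply]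

@[simp] theorem smap_single {V W : Type} {m : ℕ} (g : V → W) (σ : Δ m → V) :
    smap g (single σ (1 : R)) = single (g ∘ σ) (1 : R) := by
  simp [smap]

theorem sbd_smap {V W : Type} {m : ℕ} (g : V → W) (x : S V (m + 1)) :
    sbd (smap g x) = smap g (sbd x) := by
  refine lext (f := sbd ∘ₗ smap g) (g := smap g ∘ₗ sbd) (fun p => ?_) x
  simp [sbd_single, Function.comp_assoc]

section
variable {K E : Type} [AddCommGroup E] [Module ℝ E] [Cv K E]
variable {V W : Type}

/-- Realisation of tuples as singular simplices. -/
noncomputable def Phi {m : ℕ} (f : K → V) : T K m →ₗ[R] S V m :=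
  lmapDomain R R (fun q => f ∘ comb q)

theorem Phi_single {m : ℕ} (f : K → V) (q : Fin m → K) :
    Phi f (single q (1 : R)) = single (f ∘ comb q) (1 : R) := by
  simp [Phi]

theorem sbd_Phi {m : ℕ} (f : K → V) (x : T K (m + 1)) : sbd (Phi f x) = Phi f (tbd x) := by
  refine lext (f := sbd ∘ₗ Phi f) (g := Phi f ∘ₗ tbd) (fun p => ?_) x
  simp only [LinearMap.comp_apply, Phi_single, sbd_single, tbd_single, map_sum, map_zsmul]
  refine Finset.sum_congr rfl fun i _ => ?_
  congr 2
  funext y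
  simp [comb_map]

theorem Phi_tmap {L F : Type} [AddCommGroup F] [Module ℝ F] [Cv L F] {m : ℕ} (f : L → V)
    {h : K → L} (hh : Aff h) (x : T K m) : Phi f (tmap h x) = Phi (f ∘ h) x := by
  refine lext (f := Phi f ∘ₗ tmap h) (g := Phi (f ∘ h)) (fun p => ?_) x
  simp only [LinearMap.comp_apply, Phi_single, tmap_single]
  congr 1
  funext y
  simp [hh m p y]

theorem Phi_iot {m : ℕ} (σ : Δ m → V) : Phi σ (single (iot m) 1) = single σ 1 := by
  rw [Phi_single]
  congr 1
  funext y
  simp [comb_iot]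

theorem smap_Phi {m : ℕ} (g : V → W) (f : K → V) (x : T K m) :
    smap g (Phi f x) = Phi (g ∘ f) x := by
  refine lext (f := smap g ∘ₗ Phi f) (g := Phi (g ∘ f)) (fun p => ?_) x
  simp only [LinearMap.comp_apply, Phi_single, smap_single, Function.comp_assoc]

theorem sbd_sbd {m : ℕ} (x : S V (m + 2)) : sbd (sbd x) = 0 := by
  refine lext (f := sbd ∘ₗ sbd) (g := 0) (fun σ => ?_) x
  simp only [LinearMap.comp_apply, LinearMap.zero_apply]
  rw [← Phi_iot σ, sbd_Phi, sbd_Phi, tbd_tbd, map_zero]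

/-- Subdivision of singular chains. -/
noncomputable def ssd (m : ℕ) : S V m →ₗ[R] S V m :=
  linearCombination R (fun σ => Phi σ (sd m (single (iot m) 1)))

theorem ssd_single {m : ℕ} (σ : Δ m → V) :
    ssd m (single σ 1) = Phi σ (sd m (single (iot m) 1)) := by
  rw [ssd, linearCombination_single, one_smul]

theorem ssd_Phi {m : ℕ} (f : K → V) (x : T K m) : ssd m (Phi f x) = Phi f (sd m x) := by
  refine lext (f := ssd m ∘ₗ Phi f) (g := Phi f ∘ₗ sd (K := K) m) (fun p => ?_) x
  simp only [LinearMap.comp_apply]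
  rw [Phi_single, ssd_single, ← Phi_tmap f (aff_comb p), sd_nat (aff_comb p), tmap_single,
    comb_iot_comp]

theorem sbd_ssd {m : ℕ} (x : S V (m + 1)) : sbd (ssd (m + 1) x) = ssd m (sbd x) := by
  refine lext (f := sbd ∘ₗ ssd (m + 1)) (g := ssd m ∘ₗ sbd) (fun σ => ?_) x
  simp only [LinearMap.comp_apply]
  rw [← Phi_iot σ, ssd_Phi, sbd_Phi, sbd_Phi, ssd_Phi, tbd_sd]

/-- Homotopy between identity and subdivision of singular chains. -/
noncomputable def ssdh (m : ℕ) : S V m →ₗ[R] S V (m + 1) :=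
  linearCombination R (fun σ => Phi σ (sdh (Δ m) m (single (iot m) 1)))

theorem ssdh_single {m : ℕ} (σ : Δ m → V) :
    ssdh m (single σ 1) = Phi σ (sdh (Δ m) m (single (iot m) 1)) := by
  rw [ssdh, linearCombination_single, one_smul]

theorem ssdh_Phi {m : ℕ} (f : K → V) (x : T K m) : ssdh m (Phi f x) = Phi f (sdh K m x) := by
  refine lext (f := ssdh m ∘ₗ Phi f) (g := Phi f ∘ₗ sdh K m) (fun p => ?_) x
  simp only [LinearMap.comp_apply]
  rw [Phi_single, ssdh_single, ← Phi_tmap f (aff_comb p), sdh_nat (aff_comb p), tmap_single,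
    comb_iot_comp]

theorem ssdh_spec {m : ℕ} (x : S V (m + 1)) :
    sbd (ssdh (m + 1) x) = x - ssd (m + 1) x - ssdh m (sbd x) := by
  refine lext (f := sbd ∘ₗ ssdh (m + 1)) (g := LinearMap.id - ssd (m + 1) - ssdh m ∘ₗ sbd)
    (fun σ => ?_) x
  simp only [LinearMap.comp_apply, LinearMap.sub_apply, LinearMap.id_apply]
  rw [← Phi_iot σ, ssdh_Phi, sbd_Phi, sbd_Phi, ssdh_Phi, ssd_Phi, sdh_spec, map_sub, map_sub]

theorem aff_prod {L F : Type} [AddCommGroup F] [Module ℝ F] [Cv L F] {h : K → L} (hh : Aff h) :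
    Aff (fun y : K × Set.Icc (0 : ℝ) 1 => (h y.1, y.2)) := by
  intro m q x
  rw [comb_prod, comb_prod]
  refine Prod.ext ?_ rfl
  exact hh m _ x

theorem comb_const {m : ℕ} (c : K) (x : Δ m) : comb (fun _ => c) x = c := by
  apply Cv.inj (E := E)
  rw [emb_comb, ← Finset.sum_smul, stdSimplex.sum_eq_one, one_smul]

theorem aff_incl (c : Set.Icc (0 : ℝ) 1) : Aff (fun y : K => (y, c)) := by
  intro m q x
  rw [comb_prod]
  refine Prod.ext rfl ?_
  exact (comb_const c x).symm

/-- Prism operator on singular chains. -/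
noncomputable def spr (H : V → Set.Icc (0 : ℝ) 1 → W) (m : ℕ) : S V m →ₗ[R] S W (m + 1) :=
  linearCombination R (fun σ => Phi (fun y : Δ m × Set.Icc (0 : ℝ) 1 => H (σ y.1) y.2)
    (pr (Δ m) m (single (iot m) 1)))

theorem spr_single (H : V → Set.Icc (0 : ℝ) 1 → W) {m : ℕ} (σ : Δ m → V) :
    spr H m (single σ 1) = Phi (fun y : Δ m × Set.Icc (0 : ℝ) 1 => H (σ y.1) y.2)
    (pr (Δ m) m (single (iot m) 1)) := by
  rw [spr, linearCombination_single, one_smul]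

theorem spr_Phi (H : V → Set.Icc (0 : ℝ) 1 → W) {m : ℕ} (f : K → V) (x : T K m) :
    spr H m (Phi f x) = Phi (fun y : K × Set.Icc (0 : ℝ) 1 => H (f y.1) y.2) (pr K m x) := by
  refine lext (f := spr H m ∘ₗ Phi f)
    (g := Phi (fun y : K × Set.Icc (0 : ℝ) 1 => H (f y.1) y.2) ∘ₗ pr K m) (fun p => ?_) x
  simp only [LinearMap.comp_apply]
  have h1 := Phi_tmap (fun y : K × Set.Icc (0 : ℝ) 1 => H (f y.1) y.2)
    (aff_prod (aff_comb p)) (pr (Δ m) m (single (iot m) 1))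
  rw [Phi_single, spr_single]
  rw [pr_nat, tmap_single, comb_iot_comp] at h1
  exact h1.symm

theorem spr_spec (H : V → Set.Icc (0 : ℝ) 1 → W) {m : ℕ} (x : S V (m + 1)) :
    sbd (spr H (m + 1) x) =
      smap (fun v => H v 1) x - smap (fun v => H v 0) x - spr H m (sbd x) := by
  refine lext (f := sbd ∘ₗ spr H (m + 1))
    (g := smap (fun v => H v 1) - smap (fun v => H v 0) - spr H m ∘ₗ sbd) (fun σ => ?_) x
  simp only [LinearMap.comp_apply, LinearMap.sub_apply]
  rw [← Phi_iot σ, spr_Phi, sbd_Phi, sbd_Phi, spr_Phi, pr_spec, map_sub, map_sub,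
    Phi_tmap _ (aff_incl 1), Phi_tmap _ (aff_incl 0), smap_Phi, smap_Phi]
  rfl
end

/-! ### Continuous chains in a subset -/
section
variable {V W : Type} [TopologicalSpace V] [TopologicalSpace W]

/-- Simplices which are continuous and have range in `A`. -/
def Spx (A : Set V) (m : ℕ) : Set (Δ m → V) := {σ | Continuous σ ∧ ∀ x, σ x ∈ A}

/-- Singular chains in `A`. -/
noncomputable def Ch (A : Set V) (m : ℕ) : Submodule R (S V m) := supported R R (Spx A m)

theorem single_mem_Ch {A : Set V} {m : ℕ} {σ : Δ m → V} (h : σ ∈ Spx A m) :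
    single σ (1 : R) ∈ Ch A m := single_mem_supported R _ h

theorem Ch_induction {A : Set V} {m : ℕ} {N : Type} [AddCommGroup N] [Module R N]
    (f : S V m →ₗ[R] N) (P : Submodule R N)
    (h : ∀ σ ∈ Spx A m, f (single σ 1) ∈ P) {x : S V m} (hx : x ∈ Ch A m) : f x ∈ P := by
  rw [Ch, supported_eq_span_single] at hx
  have : Submodule.span R ((fun i => single i (1 : R)) '' Spx A m) ≤ P.comap f := by
    rw [Submodule.span_le]
    rintro _ ⟨σ, hσ, rfl⟩
    exact h σ hσ
  exact this hx

theorem Ch_congr {A : Set V} {m : ℕ} {N : Type} [AddCommGroup N] [Module R N]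
    (f g : S V m →ₗ[R] N) (h : ∀ σ ∈ Spx A m, f (single σ 1) = g (single σ 1)) {x : S V m}
    (hx : x ∈ Ch A m) : f x = g x := by
  have := Ch_induction (f - g) ⊥ (fun σ hσ => by simp [h σ hσ]) hx
  simpa [sub_eq_zero] using this

theorem Ch_mono {A B : Set V} (h : A ⊆ B) (m : ℕ) : Ch A m ≤ Ch B m :=
  supported_mono fun _ hσ => ⟨hσ.1, fun x => h (hσ.2 x)⟩

theorem Ch_inter {A B : Set V} {m : ℕ} {x : S V m} (ha : x ∈ Ch A m) (hb : x ∈ Ch B m) :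
    x ∈ Ch (A ∩ B) m := by
  have : Spx (A ∩ B) m = Spx A m ∩ Spx B m := by
    ext σ
    simp only [Spx, Set.mem_ofPred_eq, Set.mem_inter_iff]
    grind
  rw [Ch, this, supported_inter]
  exact ⟨ha, hb⟩

theorem sbd_mem {A : Set V} {m : ℕ} {x : S V (m + 1)} (hx : x ∈ Ch A (m + 1)) :
    sbd x ∈ Ch A m := by
  refine Ch_induction sbd _ (fun σ hσ => ?_) hx
  rw [sbd_single]
  refine Submodule.sum_mem _ fun i _ => zsmul_mem (single_mem_Ch ⟨?_, fun x => hσ.2 _⟩) _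
  exact hσ.1.comp (stdSimplex.continuous_map _)

theorem smap_mem {A : Set V} {B : Set W} {m : ℕ} {g : V → W} (hg : ContinuousOn g A)
    (hm : Set.MapsTo g A B) {x : S V m} (hx : x ∈ Ch A m) : smap g x ∈ Ch B m := by
  refine Ch_induction (smap g) _ (fun σ hσ => ?_) hx
  rw [smap_single]
  exact single_mem_Ch ⟨hg.comp_continuous hσ.1 hσ.2, fun x => hm (hσ.2 x)⟩

theorem smap_id_mem {A : Set V} {m : ℕ} {g : V → V} (hg : ∀ v ∈ A, g v = v)
    {x : S V m} (hx : x ∈ Ch A m) : smap g x = x := by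
  refine Ch_congr (smap g) LinearMap.id (fun σ hσ => ?_) hx
  rw [smap_single, LinearMap.id_apply]
  congr 1
  funext y
  exact hg _ (hσ.2 y)

theorem continuous_comb_Δ {n m : ℕ} (q : Fin m → Δ n) : Continuous (comb q) := by
  refine Continuous.subtype_mk (f := fun x : Δ m => ∑ i, x i • (q i).1) ?_ _
  refine continuous_finsetSum _ fun i _ => ?_
  have h : Continuous (fun x : Δ m => (x.1 i : ℝ)) :=
    (continuous_apply i).comp continuous_subtype_val
  exact h.smul continuous_const

theorem continuous_comb_I {m : ℕ} (q : Fin m → Set.Icc (0 : ℝ) 1) : Continuous (comb q) := by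
  refine Continuous.subtype_mk (f := fun x : Δ m => ∑ i, x i • (q i).1) ?_ _
  refine continuous_finsetSum _ fun i _ => ?_
  have h : Continuous (fun x : Δ m => (x.1 i : ℝ)) :=
    (continuous_apply i).comp continuous_subtype_val
  exact h.smul continuous_const

theorem continuous_comb_prod {n m : ℕ} (q : Fin m → Δ n × Set.Icc (0 : ℝ) 1) :
    Continuous (comb q) :=
  (continuous_comb_Δ _).prodMk (continuous_comb_I _)

theorem Phi_mem {K E : Type} [AddCommGroup E] [Module ℝ E] [Cv K E] [TopologicalSpace K]
    (hK : ∀ {m : ℕ} (q : Fin m → K), Continuous (comb q)) {A : Set V} {f : K → V}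
    (hf : Continuous f) (hA : ∀ y, f y ∈ A) {m : ℕ} (x : T K m) : Phi f x ∈ Ch A m := by
  have h1 : ((Ch A m).mkQ ∘ₗ Phi f) x = 0 := by
    refine lext (f := (Ch A m).mkQ ∘ₗ Phi f) (g := 0) (fun q => ?_) x
    rw [LinearMap.comp_apply, Phi_single, LinearMap.zero_apply, Submodule.mkQ_apply,
      Submodule.Quotient.mk_eq_zero]
    exact single_mem_Ch ⟨hf.comp (hK q), fun x => hA _⟩
  rwa [LinearMap.comp_apply, Submodule.mkQ_apply, Submodule.Quotient.mk_eq_zero] at h1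

theorem ssd_mem {A : Set V} {m : ℕ} {x : S V m} (hx : x ∈ Ch A m) : ssd m x ∈ Ch A m := by
  refine Ch_induction (ssd m) _ (fun σ hσ => ?_) hx
  rw [ssd_single]
  exact Phi_mem continuous_comb_Δ hσ.1 hσ.2 _

theorem ssdh_mem {A : Set V} {m : ℕ} {x : S V m} (hx : x ∈ Ch A m) :
    ssdh m x ∈ Ch A (m + 1) := by
  refine Ch_induction (ssdh m) _ (fun σ hσ => ?_) hx
  rw [ssdh_single]
  exact Phi_mem continuous_comb_Δ hσ.1 hσ.2 _

theorem spr_mem {A : Set V} {B : Set W} {H : V → Set.Icc (0 : ℝ) 1 → W}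
    (hc : ContinuousOn (fun y : V × Set.Icc (0 : ℝ) 1 => H y.1 y.2) (A ×ˢ Set.univ))
    (hm : ∀ v ∈ A, ∀ t, H v t ∈ B)
    {m : ℕ} {x : S V m} (hx : x ∈ Ch A m) : spr H m x ∈ Ch B (m + 1) := by
  refine Ch_induction (spr H m) _ (fun σ hσ => ?_) hx
  rw [spr_single]
  refine Phi_mem continuous_comb_prod ?_ (fun y => hm _ (hσ.2 _) _) _
  exact hc.comp_continuous (f := fun y : Δ m × Set.Icc (0 : ℝ) 1 => (σ y.1, y.2))
    ((hσ.1.comp continuous_fst).prodMk continuous_snd) (fun y => ⟨hσ.2 _, trivial⟩)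

/-! ### Vanishing of relative homology -/

/-- `H_j(B, A) = 0`. -/
def Rel (j : ℕ) (A B : Set V) : Prop :=
  ∀ z ∈ Ch B (j + 1), sbd z ∈ Ch A j → ∃ w ∈ Ch B (j + 2), z - sbd w ∈ Ch A (j + 1)

theorem Rel.trans {j : ℕ} {A B C : Set V} (hAB : A ⊆ B) (hBC : B ⊆ C)
    (h1 : Rel j A B) (h2 : Rel j B C) : Rel j A C := by
  intro z hz hdz
  obtain ⟨w, hw, hy⟩ := h2 z hz (Ch_mono hAB _ hdz)
  obtain ⟨u, hu, hx⟩ := h1 _ hy (by simpa [sbd_sbd] using hdz)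
  refine ⟨w + u, add_mem hw (Ch_mono hBC _ hu), ?_⟩
  rwa [map_add, ← sub_sub]

theorem Rel.left {j : ℕ} {A B C : Set V} (hAB : A ⊆ B) (hBC : B ⊆ C)
    (h1 : Rel j A C) (h2 : Rel (j + 1) B C) : Rel j A B := by
  intro z hz hdz
  obtain ⟨w, hw, hx⟩ := h1 z (Ch_mono hBC _ hz) hdz
  obtain ⟨u, hu, hy⟩ := h2 w hw (by
    have := sub_mem hz (Ch_mono hAB _ hx)
    simpa using this)
  refine ⟨w - sbd u, hy, ?_⟩
  simpa [sbd_sbd] using hx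

theorem Rel.right_zero {A B C : Set V} (hAB : A ⊆ B) (h1 : Rel 0 A C) : Rel 0 B C := by
  intro z hz _
  obtain ⟨w, hw, hx⟩ := h1 z hz (by
    refine Ch_induction sbd _ (fun σ hσ => ?_) hz
    rw [sbd_single]
    refine Submodule.sum_mem _ fun i _ => zsmul_mem (single_mem_Ch ?_) _
    have : IsEmpty (Δ 0) := by
      rw [Set.isEmpty_coe_sort]
      exact stdSimplex_of_isEmpty_index ℝ (Fin 0)
    exact ⟨continuous_of_const (fun x => isEmptyElim x), fun x => isEmptyElim x⟩)
  exact ⟨w, hw, Ch_mono hAB _ hx⟩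

theorem Rel.right_succ {j : ℕ} {A B C : Set V} (hAB : A ⊆ B) (hBC : B ⊆ C)
    (h1 : Rel (j + 1) A C) (h2 : Rel j A B) : Rel (j + 1) B C := by
  intro z hz hdz
  obtain ⟨y, hy, hx⟩ := h2 (sbd z) hdz (by rw [sbd_sbd]; exact zero_mem _)
  obtain ⟨w, hw, ha⟩ := h1 (z - y) (sub_mem hz (Ch_mono hBC _ hy)) (by simpa using hx)
  refine ⟨w, hw, ?_⟩
  have := add_mem (Ch_mono hAB _ ha) hy
  convert this using 1
  abel

/-- `H_*(B, A) = 0`. -/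
def ARel (A B : Set V) : Prop := ∀ j, Rel j A B

theorem ARel.trans {A B C : Set V} (hAB : A ⊆ B) (hBC : B ⊆ C)
    (h1 : ARel A B) (h2 : ARel B C) : ARel A C := fun j => (h1 j).trans hAB hBC (h2 j)

theorem ARel.left {A B C : Set V} (hAB : A ⊆ B) (hBC : B ⊆ C)
    (h1 : ARel A C) (h2 : ARel B C) : ARel A B := fun j => (h1 j).left hAB hBC (h2 _)

theorem ARel.right {A B C : Set V} (hAB : A ⊆ B) (hBC : B ⊆ C)
    (h1 : ARel A C) (h2 : ARel A B) : ARel B C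
  | 0 => (h1 0).right_zero hAB
  | j + 1 => (h1 (j + 1)).right_succ hAB hBC (h2 j)

/-- Homotopy invariance. -/
theorem ARel.of_homotopy {A B : Set V} (hAB : A ⊆ B) (H : V → Set.Icc (0 : ℝ) 1 → V)
    (hc : ContinuousOn (fun y : V × Set.Icc (0 : ℝ) 1 => H y.1 y.2) (B ×ˢ Set.univ))
    (hB : ∀ v ∈ B, ∀ t, H v t ∈ B) (hA : ∀ v ∈ A, ∀ t, H v t ∈ A)
    (h0 : ∀ v ∈ B, H v 0 = v) (h1 : ∀ v ∈ B, H v 1 ∈ A) : ARel A B := by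
  intro j z hz hdz
  have key := spr_spec H z
  rw [smap_id_mem h0 hz] at key
  refine ⟨- spr H (j + 1) z, neg_mem (spr_mem hc hB hz), ?_⟩
  have e1 : z - sbd (-spr H (j + 1) z) = smap (fun v => H v 1) z - spr H j (sbd z) := by
    rw [map_neg, key]
    abel
  rw [e1]
  refine sub_mem (smap_mem ?_ h1 hz)
    (spr_mem (hc.mono (Set.prod_mono hAB subset_rfl)) hA hdz)
  exact hc.comp (f := fun v => (v, (1 : Set.Icc (0 : ℝ) 1))) (by fun_prop) (fun v hv => ⟨hv, trivial⟩)

/-- Transport along a homeomorphism. -/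
theorem Rel.transport {j : ℕ} {A B : Set V} {A' B' : Set W} (hA'B' : A' ⊆ B') (hAB : A ⊆ B)
    (g : V → W) (h : W → V)
    (hg : ContinuousOn g B) (hh : ContinuousOn h B') (hgB : Set.MapsTo g B B')
    (hgA : Set.MapsTo g A A') (hhB : Set.MapsTo h B' B) (hhA : Set.MapsTo h A' A)
    (hgh : ∀ w ∈ B', g (h w) = w) (hr : Rel j A B) : Rel j A' B' := by
  intro z hz hdz
  obtain ⟨w, hw, hx⟩ := hr (smap h z) (smap_mem hh hhB hz)
    (by rw [sbd_smap]; exact smap_mem (hh.mono hA'B') hhA hdz)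
  refine ⟨smap g w, smap_mem hg hgB hw, ?_⟩
  have h2 := smap_mem (hg.mono hAB) hgA hx
  rw [map_sub, ← sbd_smap] at h2
  have h3 : smap g (smap h z) = z := by
    refine Ch_congr (smap g ∘ₗ smap h) LinearMap.id (fun σ hσ => ?_) hz
    simp only [LinearMap.comp_apply, smap_single, LinearMap.id_apply]
    congr 1
    funext y
    exact hgh _ (hσ.2 y)
  rwa [h3] at h2
end
end CubeDel

namespace CubeDel
open Finsupp
/-! ### Small chains -/

theorem dist_comb_le {n m : ℕ} (p : Fin m → Δ n) (x : Δ m) (z : Δ n) (e : ℝ)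
    (h : ∀ i, dist (p i) z ≤ e) : dist (comb p x) z ≤ e := by
  have h1 : (comb p x).1 = ∑ i, x i • (p i).1 := rfl
  have h2 : (comb p x).1 ∈ Metric.closedBall z.1 e := by
    rw [h1]
    refine (convex_closedBall z.1 e).sum_mem (fun i _ => x.2.1 i) x.2.2 (fun i _ => ?_)
    exact h i
  exact h2

theorem dist_bary_le {n k N : ℕ} (hk : k ≤ N) (p : Fin (k + 1) → Δ n) (c : ℝ)
    (h : ∀ i j, dist (p i) (p j) ≤ c) (i : Fin (k + 1)) :
    dist (p i) (bary k p) ≤ (N / (N + 1) : ℝ) * c := by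
  have hc : 0 ≤ c := dist_nonneg.trans (h i i)
  have h1 : (bary k p).1 = ∑ j, (1 / ((k : ℝ) + 1)) • (p j).1 := by
    show ∑ j, (stdSimplex.barycenter (𝕜 := ℝ) (X := Fin (k + 1))) j • (p j).1 = _
    refine Finset.sum_congr rfl fun j _ => ?_
    congr 1
    refine (stdSimplex.barycenter_apply (𝕜 := ℝ) j).trans ?_
    simp
  have h2 : (p i).1 - (bary k p).1 = (1 / ((k : ℝ) + 1)) • ∑ j ∈ Finset.univ.erase i, ((p i).1 - (p j).1) := by
    rw [h1, ← Finset.smul_sum, Finset.sum_erase, Finset.sum_sub_distrib, smul_sub]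
    · congr 1
      simp only [Finset.sum_const, Finset.card_univ, Fintype.card_fin]
      rw [← Nat.cast_smul_eq_nsmul ℝ, smul_smul]
      push_cast
      rw [one_div, inv_mul_cancel₀ (by positivity), one_smul]
    · simp
  have h3 : dist (p i) (bary k p) = ‖(p i).1 - (bary k p).1‖ := by
    rw [← dist_eq_norm]; rfl
  rw [h3, h2, norm_smul]
  have h4 : ‖∑ j ∈ Finset.univ.erase i, ((p i).1 - (p j).1)‖ ≤ k * c := by
    refine (norm_sum_le_of_le _ (f := fun j => (p i).1 - (p j).1) (n := fun _ => c) fun j _ => ?_).trans ?_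
    · rw [← dist_eq_norm]; exact h i j
    · simp
  have h5 : ‖(1 / ((k : ℝ) + 1))‖ = 1 / ((k : ℝ) + 1) := Real.norm_of_nonneg (by positivity)
  rw [h5]
  calc 1 / ((k : ℝ) + 1) * ‖∑ j ∈ Finset.univ.erase i, ((p i).1 - (p j).1)‖
      ≤ 1 / ((k : ℝ) + 1) * (k * c) := by gcongr
    _ = (k / (k + 1) : ℝ) * c := by ring
    _ ≤ _ := by
      gcongr ?_ * _
      have : (k : ℝ) ≤ N := by exact_mod_cast hk
      rw [div_le_div_iff₀ (by positivity) (by positivity)]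
      nlinarith

/-- Every ball containing `p` contains `q`. -/
def Hull {n k l : ℕ} (q : Fin k → Δ n) (p : Fin l → Δ n) : Prop :=
  ∀ z e, (∀ i, dist (p i) z ≤ e) → ∀ j, dist (q j) z ≤ e

theorem sd_small {n : ℕ} (N : ℕ) (k : ℕ) (hk : k ≤ N + 1) (c : ℝ) (p : Fin k → Δ n)
    (h : ∀ i j, dist (p i) (p j) ≤ c) :
    sd k (single p 1) ∈ supported R R
      {q : Fin k → Δ n | Hull q p ∧ ∀ i j, dist (q i) (q j) ≤ (N / (N + 1) : ℝ) * c} := by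
  induction k with
  | zero =>
    rw [sd_zero]
    exact single_mem_supported R _ ⟨fun z e h => h, fun i => i.elim0⟩
  | succ k ih =>
    have hc : 0 ≤ c := dist_nonneg.trans (h 0 0)
    rw [sd_single, tbd_single, map_sum, map_sum]
    refine Submodule.sum_mem _ fun i _ => ?_
    rw [map_zsmul, map_zsmul]
    refine zsmul_mem ?_ _
    have h1 := ih (by omega) (p ∘ i.succAbove) (fun a b => h _ _)
    generalize sd k (single (p ∘ i.succAbove) 1) = y at h1
    rw [supported_eq_span_single] at h1
    have : Submodule.span R ((fun i => single i (1 : R)) '' {q : Fin k → Δ n | Hull q (p ∘ i.succAbove) ∧ ∀ i j, dist (q i) (q j) ≤ (N / (N + 1) : ℝ) * c}) ≤ (supported R R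
      {q : Fin (k+1) → Δ n | Hull q p ∧ ∀ i j, dist (q i) (q j) ≤ (N / (N + 1) : ℝ) * c}).comap
        (cone (bary k p)) := by
      rw [Submodule.span_le]
      rintro _ ⟨q, ⟨hq1, hq2⟩, rfl⟩
      rw [SetLike.mem_coe, Submodule.mem_comap]
      rw [cone_single]
      refine single_mem_supported R _ ⟨?_, ?_⟩
      · intro z e hz j
        refine Fin.cases ?_ (fun j => ?_) j
        · exact dist_comb_le _ _ _ _ hz
        · simpa using hq1 z e (fun a => hz _) j
      · have hb : ∀ j, dist (q j) (bary k p) ≤ (N / (N + 1) : ℝ) * c :=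
          hq1 _ _ (fun a => dist_bary_le (by omega) p c h _)
        intro a b
        refine Fin.cases ?_ (fun a => ?_) a <;> refine Fin.cases ?_ (fun b => ?_) b
        · simp only [dist_self]; positivity
        · simpa [dist_comm] using hb b
        · simpa using hb a
        · simpa using hq2 a b
    exact this h1

theorem sd_pow_small {n : ℕ} (m : ℕ) (c : ℝ) (x : T (Δ n) (m + 1))
    (h : x ∈ supported R R {q : Fin (m + 1) → Δ n | ∀ i j, dist (q i) (q j) ≤ c}) (M : ℕ) :
    (sd (K := Δ n) (m + 1) ^ M) x ∈ supported R R
      {q : Fin (m + 1) → Δ n | ∀ i j, dist (q i) (q j) ≤ (m / (m + 1) : ℝ) ^ M * c} := by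
  induction M with
  | zero => simpa using h
  | succ M ih =>
    rw [pow_succ' (sd (K := Δ n) (m + 1)), Module.End.mul_apply]
    generalize (sd (K := Δ n) (m + 1) ^ M) x = y at ih
    rw [supported_eq_span_single] at ih
    have : Submodule.span R ((fun i => single i (1 : R)) ''
        {q : Fin (m + 1) → Δ n | ∀ i j, dist (q i) (q j) ≤ (m / (m + 1) : ℝ) ^ M * c}) ≤
        (supported R R {q : Fin (m + 1) → Δ n | ∀ i j, dist (q i) (q j) ≤
          (m / (m + 1) : ℝ) ^ (M + 1) * c}).comap (sd (m + 1)) := by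
      rw [Submodule.span_le]
      rintro _ ⟨q, hq, rfl⟩
      rw [SetLike.mem_coe, Submodule.mem_comap]
      refine supported_mono ?_ (sd_small m (m + 1) le_rfl _ q hq)
      rintro q' ⟨-, h2⟩ i j
      rw [pow_succ', mul_assoc]
      exact h2 i j
    exact this ih

section
set_option linter.unusedSectionVars false
variable {V : Type} [TopologicalSpace V]

theorem ssd_pow_Phi {K E : Type} [AddCommGroup E] [Module ℝ E] [Cv K E] {m : ℕ} (f : K → V)
    (M : ℕ) (x : T K m) : (ssd m ^ M) (Phi f x) = Phi f ((sd (K := K) m ^ M) x) := by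
  induction M with
  | zero => simp
  | succ M ih => 
    rw [pow_succ', pow_succ', Module.End.mul_apply, Module.End.mul_apply, ih, ssd_Phi]

theorem ssd_pow_mem {A : Set V} {m : ℕ} (M : ℕ) {x : S V m} (hx : x ∈ Ch A m) :
    (ssd m ^ M) x ∈ Ch A m := by
  induction M with
  | zero => simpa using hx
  | succ M ih => rw [pow_succ', Module.End.mul_apply]; exact ssd_mem ih

theorem sbd_ssd_pow {m : ℕ} (M : ℕ) (x : S V (m + 1)) :
    sbd ((ssd (m + 1) ^ M) x) = (ssd m ^ M) (sbd x) := by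
  induction M with
  | zero => simp
  | succ M ih =>
    rw [pow_succ', pow_succ', Module.End.mul_apply, Module.End.mul_apply, sbd_ssd, ih]

/-- Homotopy between the identity and iterated subdivision. -/
noncomputable def ssdH (M m : ℕ) : S V m →ₗ[R] S V (m + 1) :=
  ∑ i ∈ Finset.range M, ssdh m ∘ₗ (ssd m ^ i)

theorem ssdH_mem {A : Set V} {m : ℕ} (M : ℕ) {x : S V m} (hx : x ∈ Ch A m) :
    ssdH M m x ∈ Ch A (m + 1) := by
  rw [ssdH, LinearMap.sum_apply]
  exact Submodule.sum_mem _ fun i _ => ssdh_mem (ssd_pow_mem i hx)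

theorem ssdH_spec (M : ℕ) {m : ℕ} (x : S V (m + 1)) :
    sbd (ssdH M (m + 1) x) = x - (ssd (m + 1) ^ M) x - ssdH M m (sbd x) := by
  induction M with
  | zero => simp [ssdH]
  | succ M ih =>
    have e : ∀ (m : ℕ) (y : S V m), ssdH (M + 1) m y = ssdH M m y + ssdh m ((ssd m ^ M) y) := by
      intro m y
      simp only [ssdH, Finset.sum_range_succ, LinearMap.add_apply, LinearMap.comp_apply]
    rw [e, e, map_add, ih, ssdh_spec, sbd_ssd_pow, pow_succ', Module.End.mul_apply]
    abel

theorem small {A B OA OB : Set V} (hOA : IsOpen OA) (hOB : IsOpen OB)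
    (hA : A = (A ∪ B) ∩ OA) (hB : B = (A ∪ B) ∩ OB) {m : ℕ} {z : S V (m + 1)}
    (hz : z ∈ Ch (A ∪ B) (m + 1)) :
    ∃ M, ∃ a ∈ Ch A (m + 1), ∃ b ∈ Ch B (m + 1), (ssd (m + 1) ^ M) z = a + b := by
  suffices h : ∃ N, ∀ M ≥ N, (ssd (m + 1) ^ M) z ∈ Ch A (m + 1) ⊔ Ch B (m + 1) by
    obtain ⟨N, h⟩ := h
    obtain ⟨a, ha, b, hb, e⟩ := Submodule.mem_sup.1 (h N le_rfl)
    exact ⟨N, a, ha, b, hb, e.symm⟩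
  let P : Submodule R (S V (m + 1)) :=
    { carrier := {z | ∃ N, ∀ M ≥ N, (ssd (m + 1) ^ M) z ∈ Ch A (m + 1) ⊔ Ch B (m + 1)}
      add_mem' := by
        rintro x y ⟨N, hN⟩ ⟨N', hN'⟩
        refine ⟨max N N', fun M hM => ?_⟩
        rw [map_add]
        exact add_mem (hN M (le_of_max_le_left hM)) (hN' M (le_of_max_le_right hM))
      zero_mem' := ⟨0, fun M _ => by rw [map_zero]; exact zero_mem _⟩
      smul_mem' := by
        rintro c x ⟨N, hN⟩
        refine ⟨N, fun M hM => ?_⟩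
        rw [map_smul]
        exact Submodule.smul_mem _ _ (hN M hM) }
  refine Ch_induction LinearMap.id P (fun σ hσ => ?_) hz
  obtain ⟨hσc, hσ⟩ := hσ
  let cov : Bool → Set (Δ (m + 1)) := fun t => σ ⁻¹' (if t then OA else OB)
  obtain ⟨δ, hδ, hcov⟩ := lebesgue_number_lemma_of_metric (s := (Set.univ : Set (Δ (m + 1))))
    (c := cov) isCompact_univ (fun t => by
      cases t
      · exact hOB.preimage hσc
      · exact hOA.preimage hσc) (fun x _ => by
      rw [Set.mem_iUnion]
      rcases hσ x with h | h
      · exact ⟨true, by rw [hA] at h; exact h.2⟩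
      · exact ⟨false, by rw [hB] at h; exact h.2⟩)
  let c := Metric.diam (Set.univ : Set (Δ (m + 1)))
  have hlim : Filter.Tendsto (fun M : ℕ => (m / (m + 1) : ℝ) ^ M * c) Filter.atTop (nhds (0 * c)) := by
    refine Filter.Tendsto.mul_const _ (tendsto_pow_atTop_nhds_zero_of_lt_one (by positivity) ?_)
    rw [div_lt_one (by positivity)]
    linarith
  rw [zero_mul] at hlim
  obtain ⟨N, hN⟩ := Filter.eventually_atTop.1 (hlim.eventually_lt_const hδ)
  refine ⟨N, fun M hM => ?_⟩
  rw [LinearMap.id_apply, ← Phi_iot σ, ssd_pow_Phi]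
  have h1 := sd_pow_small m c (single (iot (m + 1)) 1) (single_mem_supported R _ (fun i j =>
    Metric.dist_le_diam_of_mem isCompact_univ.isBounded trivial trivial)) M
  generalize (sd (K := Δ (m + 1)) (m + 1) ^ M) (single (iot (m + 1)) 1) = y at h1
  rw [supported_eq_span_single] at h1
  have : Submodule.span R ((fun i => single i (1 : R)) ''
        {q : Fin (m + 1) → Δ (m + 1) | ∀ i j, dist (q i) (q j) ≤ (m / (m + 1) : ℝ) ^ M * c}) ≤
        (Ch A (m + 1) ⊔ Ch B (m + 1)).comap (Phi σ) := by
    rw [Submodule.span_le]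
    rintro _ ⟨q, hq, rfl⟩
    rw [SetLike.mem_coe, Submodule.mem_comap]
    rw [Phi_single]
    obtain ⟨t, ht⟩ := hcov (q 0) trivial
    have hx : ∀ x, comb q x ∈ cov t := fun x => ht (by
      rw [Metric.mem_ball]
      exact (dist_comb_le q x (q 0) _ (fun i => hq i 0)).trans_lt (hN M hM))
    cases t
    · refine Submodule.mem_sup_right (single_mem_Ch ⟨hσc.comp (continuous_comb_Δ q), fun x => ?_⟩)
      rw [hB]
      exact ⟨hσ _, hx x⟩
    · refine Submodule.mem_sup_left (single_mem_Ch ⟨hσc.comp (continuous_comb_Δ q), fun x => ?_⟩)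
      rw [hA]
      exact ⟨hσ _, hx x⟩
  exact this h1

/-- Relatively open. -/
def RO (A X : Set V) : Prop := ∃ O, IsOpen O ∧ A = X ∩ O

/-- Excision, first direction. -/
theorem Rel.excision {j : ℕ} {A B : Set V} (hA : RO A (A ∪ B)) (hB : RO B (A ∪ B))
    (h : Rel j (A ∩ B) B) : Rel j A (A ∪ B) := by
  obtain ⟨OA, hOA, hA⟩ := hA
  obtain ⟨OB, hOB, hB⟩ := hB
  intro z hz hdz
  obtain ⟨M, a, ha, b, hb, e⟩ := small hOA hOB hA hB hz
  have hD := ssdH_spec M z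
  have hdb : sbd b ∈ Ch (A ∩ B) j := by
    refine Ch_inter ?_ (sbd_mem hb)
    have : sbd b = (ssd j ^ M) (sbd z) - sbd a := by
      rw [← sbd_ssd_pow, e, map_add]; abel
    rw [this]
    exact sub_mem (ssd_pow_mem M hdz) (sbd_mem ha)
  obtain ⟨w, hw, hx⟩ := h b hb hdb
  refine ⟨ssdH M (j + 1) z + w, add_mem (ssdH_mem M hz) (Ch_mono Set.subset_union_right _ hw), ?_⟩
  have : z - sbd (ssdH M (j + 1) z + w) = a + (b - sbd w) + ssdH M j (sbd z) := by
    rw [map_add, hD, e]; abel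
  rw [this]
  exact add_mem (add_mem ha (Ch_mono Set.inter_subset_left _ hx)) (ssdH_mem M hdz)

/-- Excision, second direction. -/
theorem Rel.excision' {j : ℕ} {A B : Set V} (hA : RO A (A ∪ B)) (hB : RO B (A ∪ B))
    (h : Rel j A (A ∪ B)) : Rel j (A ∩ B) B := by
  obtain ⟨OA, hOA, hA⟩ := hA
  obtain ⟨OB, hOB, hB⟩ := hB
  intro z hz hdz
  obtain ⟨w, hw, hx⟩ := h z (Ch_mono Set.subset_union_right _ hz)
    (Ch_mono Set.inter_subset_left _ hdz)
  obtain ⟨M, a, ha, b, hb, e⟩ := small hOA hOB hA hB hw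
  have hD := ssdH_spec M z
  refine ⟨ssdH M (j + 1) z + b, add_mem (ssdH_mem M hz) hb, ?_⟩
  have h1 : (ssd (j + 1) ^ M) z - sbd b ∈ Ch (A ∩ B) (j + 1) := by
    refine Ch_inter ?_ (sub_mem (ssd_pow_mem M hz) (sbd_mem hb))
    have : (ssd (j + 1) ^ M) z - sbd b = (ssd (j + 1) ^ M) (z - sbd w) + sbd a := by
      rw [map_sub, ← sbd_ssd_pow, e, map_add]; abel
    rw [this]
    exact add_mem (ssd_pow_mem M hx) (sbd_mem ha)
  have : z - sbd (ssdH M (j + 1) z + b) =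
      ((ssd (j + 1) ^ M) z - sbd b) + ssdH M j (sbd z) := by
    rw [map_add, hD]; abel
  rw [this]
  exact add_mem h1 (ssdH_mem M hdz)
end
end CubeDel

namespace CubeDel
open Finsupp
/-! ### Local homology of Euclidean space -/

theorem RO.mono {V : Type} [TopologicalSpace V] {A X Y : Set V} (h : RO A X) (h1 : A ⊆ Y)
    (h2 : Y ⊆ X) : RO A Y := by
  obtain ⟨O, hO, e⟩ := h
  refine ⟨O, hO, Set.Subset.antisymm (fun x hx => ⟨h1 hx, ?_⟩) (fun x hx => ?_)⟩
  · rw [e] at hx; exact hx.2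
  · rw [e]; exact ⟨h2 hx.1, hx.2⟩

theorem RO.of_closed {V : Type} [TopologicalSpace V] {X C : Set V} (h : IsClosed C) :
    RO (X \ C) X := ⟨Cᶜ, h.isOpen_compl, rfl⟩

theorem RO.of_open {V : Type} [TopologicalSpace V] {A X : Set V} (h : IsOpen A) (hA : A ⊆ X) :
    RO A X := ⟨A, h, (Set.inter_eq_right.2 hA).symm⟩

/-- Model Euclidean space. -/
abbrev Eu (d : ℕ) := EuclideanSpace ℝ (Fin d)

/-- Coordinate subspace. -/
def CZ {d : ℕ} (T : Finset (Fin d)) : Set (Eu d) := {x | ∀ i ∈ T, x i = 0}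

theorem isClosed_CZ {d : ℕ} (T : Finset (Fin d)) : IsClosed (CZ T) := by
  have : CZ T = ⋂ i ∈ T, {x : Eu d | x i = 0} := by
    ext x; simp [CZ]
  rw [this]
  exact isClosed_biInter fun i _ => isClosed_eq (by fun_prop) continuous_const

theorem half_rel {d : ℕ} (T : Finset (Fin d)) (i : Fin d) (hi : i ∉ T) (s : ℝ)
    (hs : s = 1 ∨ s = -1) : ARel (CZ T ∩ {x | 0 ≤ s * x i})ᶜ (Set.univ : Set (Eu d)) := by
  have hss : s * s = 1 := by rcases hs with rfl | rfl <;> norm_num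
  let H : Eu d → Set.Icc (0 : ℝ) 1 → Eu d := fun x t =>
    x - ((t : ℝ) * (|x i| + 1) * s) • EuclideanSpace.single i (1 : ℝ)
  have hHi : ∀ x t, H x t i = x i - (t : ℝ) * (|x i| + 1) * s := by
    intro x t; simp [H]
  have hHj : ∀ x t j, j ≠ i → H x t j = x j := by
    intro x t j hj; simp [H, hj]
  have hsi : ∀ x t, s * H x t i = s * x i - (t : ℝ) * (|x i| + 1) := by
    intro x t; rw [hHi]; linear_combination (-(t : ℝ) * (|x i| + 1)) * hss
  refine ARel.of_homotopy (Set.subset_univ _) H ?_ (fun _ _ _ => trivial) ?_ ?_ ?_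
  · apply Continuous.continuousOn
    fun_prop
  · intro x hx t hx'
    refine hx ⟨fun j hj => ?_, ?_⟩
    · have := hx'.1 j hj
      rwa [hHj x t j (by rintro rfl; exact hi hj)] at this
    · have h1 : 0 ≤ s * H x t i := hx'.2
      rw [hsi] at h1
      have h2 : 0 ≤ (t : ℝ) * (|x i| + 1) := mul_nonneg t.2.1 (by positivity)
      show 0 ≤ s * x i
      linarith
  · intro x _
    simp [H]
  · intro x _ hx'
    have h1 : 0 ≤ s * H x 1 i := hx'.2
    rw [hsi] at h1
    have h2 : s * x i ≤ |x i| := by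
      rcases hs with rfl | rfl
      · simpa using le_abs_self (x i)
      · simpa using neg_le_abs (x i)
    simp only [Set.Icc.coe_one, one_mul] at h1
    linarith

theorem CZ_rel {d : ℕ} (T : Finset (Fin d)) :
    ∀ j, j + 1 ≤ T.card → Rel j (CZ T)ᶜ (Set.univ : Set (Eu d)) := by
  induction T using Finset.induction_on with
  | empty => intro j hj; simp at hj
  | insert i T hi ih =>
    intro j hj
    rw [Finset.card_insert_of_notMem hi] at hj
    have hA := half_rel T i hi 1 (Or.inl rfl)
    have hB := half_rel T i hi (-1) (Or.inr rfl)
    have cA : IsClosed (CZ T ∩ {x : Eu d | 0 ≤ 1 * x i}) :=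
      (isClosed_CZ T).inter (isClosed_le (by fun_prop) (by fun_prop))
    have cB : IsClosed (CZ T ∩ {x : Eu d | 0 ≤ -1 * x i}) :=
      (isClosed_CZ T).inter (isClosed_le (by fun_prop) (by fun_prop))
    set A := (CZ T ∩ {x : Eu d | 0 ≤ 1 * x i})ᶜ with hAd
    set B := (CZ T ∩ {x : Eu d | 0 ≤ -1 * x i})ᶜ with hBd
    have hU : (CZ (insert i T))ᶜ = A ∪ B := by
      rw [hAd, hBd, ← Set.compl_inter]
      congr 1
      ext x
      simp only [CZ, Finset.mem_insert, Set.mem_inter_iff, Set.mem_ofPred_eq]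
      constructor
      · intro h
        have := h i (Or.inl rfl)
        exact ⟨⟨fun k hk => h k (Or.inr hk), by simp [this]⟩,
          ⟨fun k hk => h k (Or.inr hk), by simp [this]⟩⟩
      · rintro ⟨⟨h1, h2⟩, -, h3⟩ k (rfl | hk)
        · linarith
        · exact h1 k hk
    have hI : (CZ T)ᶜ = A ∩ B := by
      rw [hAd, hBd, ← Set.compl_union]
      congr 1
      ext x
      simp only [Set.mem_union, Set.mem_inter_iff, Set.mem_ofPred_eq]
      constructor
      · intro h
        rcases le_total 0 (x i) with h' | h'
        · exact Or.inl ⟨h, by linarith⟩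
        · exact Or.inr ⟨h, by linarith⟩
      · rintro (h | h) <;> exact h.1
    rw [hU]
    cases j with
    | zero => exact (hA 0).right_zero Set.subset_union_left
    | succ j =>
      have h1 := ih j (by omega)
      rw [hI] at h1
      have h2 := h1.left Set.inter_subset_right (Set.subset_univ _) (hB (j + 1))
      have h3 := Rel.excision (RO.of_open cA.isOpen_compl Set.subset_union_left)
        (RO.of_open cB.isOpen_compl Set.subset_union_right) h2
      exact (hA (j + 1)).right_succ Set.subset_union_left (Set.subset_univ _) h3

theorem point_rel {d : ℕ} (p : Eu d) (j : ℕ) (hj : j + 1 ≤ d) :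
    Rel j ({p}ᶜ : Set (Eu d)) Set.univ := by
  have h := CZ_rel (Finset.univ : Finset (Fin d)) j (by simpa using hj)
  have e : CZ (Finset.univ : Finset (Fin d)) = {0} := by
    ext x
    simp only [CZ, Finset.mem_univ, forall_const, Set.mem_ofPred_eq, Set.mem_singleton_iff]
    constructor
    · intro h; ext i; simpa using h i
    · rintro rfl i; rfl
  rw [e] at h
  refine Rel.transport (Set.subset_univ _) (Set.subset_univ _) (fun x => x + p) (fun x => x - p)
    (by fun_prop) (by fun_prop) (fun _ _ => trivial) ?_ (fun _ _ => trivial) ?_ ?_ h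
  · intro x hx; simpa using hx
  · intro x hx; simpa [sub_eq_zero] using hx
  · intro x _; simp

theorem ball_rel {d : ℕ} (c : Eu d) (r : ℝ) (hr : 0 < r) (j : ℕ) (hj : j + 1 ≤ d) :
    Rel j (Metric.ball c r \ {c}) (Metric.ball c r) := by
  have hu : ({c}ᶜ : Set (Eu d)) ∪ Metric.ball c r = Set.univ := by
    ext x
    simp only [Set.mem_union, Set.mem_compl_iff, Set.mem_singleton_iff, Set.mem_univ, iff_true]
    by_cases h : x = c
    · right; rw [h]; exact Metric.mem_ball_self hr
    · exact Or.inl h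
  have h := Rel.excision' (A := ({c}ᶜ : Set (Eu d))) (B := Metric.ball c r) (j := j)
    (RO.of_open isOpen_compl_singleton Set.subset_union_left)
    (RO.of_open Metric.isOpen_ball Set.subset_union_right) (by rw [hu]; exact point_rel c j hj)
  convert h using 1
  ext x
  simp only [Set.mem_sdiff, Set.mem_inter_iff, Set.mem_compl_iff]
  tauto

theorem ball_push {d : ℕ} (c y : Eu d) (r R : ℝ) (hr : 0 < r) (hR : 4 * r < R)
    (hy : y ∈ Metric.closedBall c r) :
    ARel (Metric.ball c R \ Metric.closedBall c r) (Metric.ball c R \ {y}) := by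
  let mu : Eu d → Set.Icc (0 : ℝ) 1 → ℝ := fun x t => 1 + (t : ℝ) * (max 1 (3 * r / ‖x - y‖) - 1)
  have hmu : ∀ x t, 1 ≤ mu x t := fun x t => by
    have : 0 ≤ (t : ℝ) * (max 1 (3 * r / ‖x - y‖) - 1) :=
      mul_nonneg t.2.1 (by linarith [le_max_left 1 (3 * r / ‖x - y‖)])
    simp only [mu]; linarith
  have hmu' : ∀ x t, mu x t ≤ max 1 (3 * r / ‖x - y‖) := fun x t => by
    have h0 : 0 ≤ max 1 (3 * r / ‖x - y‖) - 1 := by linarith [le_max_left 1 (3 * r / ‖x - y‖)]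
    have := mul_le_of_le_one_left h0 t.2.2
    simp only [mu]; linarith
  let H : Eu d → Set.Icc (0 : ℝ) 1 → Eu d := fun x t => y + mu x t • (x - y)
  have hcb : Metric.closedBall c r ⊆ Metric.ball c R :=
    Metric.closedBall_subset_ball (by linarith)
  rw [Metric.mem_closedBall, dist_eq_norm] at hy
  have hB : ∀ x, x ∈ Metric.ball c R \ {y} → ∀ t, H x t ∈ Metric.ball c R \ {y} := by
    rintro x ⟨hx, hxy⟩ t
    have hxy : x - y ≠ 0 := sub_ne_zero.2 hxy
    have hn : 0 < ‖x - y‖ := norm_pos_iff.2 hxy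
    have hm := hmu x t
    refine ⟨?_, ?_⟩
    · rcases le_total (3 * r / ‖x - y‖) 1 with h | h
      · have h1 := hmu' x t
        rw [max_eq_left h] at h1
        have : H x t = x := by
          simp only [H]; rw [le_antisymm h1 hm]; simp
        rw [this]; exact hx
      · have h1 := hmu' x t
        rw [max_eq_right h, le_div_iff₀ hn] at h1
        rw [Metric.mem_ball, dist_eq_norm]
        have : H x t - c = (y - c) + mu x t • (x - y) := by simp only [H]; abel
        rw [this]
        refine (norm_add_le _ _).trans_lt ?_
        rw [norm_smul, Real.norm_of_nonneg (by linarith)]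
        linarith
    · intro h
      have h2 : mu x t • (x - y) = 0 := by simpa [H] using h
      rw [smul_eq_zero] at h2
      rcases h2 with h2 | h2
      · linarith
      · exact hxy h2
  refine ARel.of_homotopy ?_ H ?_ hB ?_ ?_ ?_
  · rintro x ⟨hx, hx'⟩
    refine ⟨hx, ?_⟩
    rintro rfl
    exact hx' (by rw [Metric.mem_closedBall, dist_eq_norm]; exact hy)
  · have h1 : ContinuousOn (fun z : Eu d × Set.Icc (0 : ℝ) 1 => 3 * r / ‖z.1 - y‖)
        ((Metric.ball c R \ {y}) ×ˢ Set.univ) := by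
      refine ContinuousOn.div continuousOn_const (by fun_prop) ?_
      rintro ⟨x, t⟩ ⟨hx, -⟩
      exact (norm_pos_iff.2 (sub_ne_zero.2 hx.2)).ne'
    have h2 : ContinuousOn (fun z : Eu d × Set.Icc (0 : ℝ) 1 => mu z.1 z.2)
        ((Metric.ball c R \ {y}) ×ˢ Set.univ) := by
      have h3 : ContinuousOn (fun z : Eu d × Set.Icc (0 : ℝ) 1 => max 1 (3 * r / ‖z.1 - y‖))
        ((Metric.ball c R \ {y}) ×ˢ Set.univ) := continuousOn_const.sup h1
      fun_prop
    fun_prop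
  · rintro x ⟨hx, hx'⟩ t
    refine ⟨(hB x ⟨hx, ?_⟩ t).1, ?_⟩
    · rintro rfl
      exact hx' (by rw [Metric.mem_closedBall, dist_eq_norm]; exact hy)
    · intro h
      apply hx'
      have hm := hmu x t
      have e : x = (1 - (mu x t)⁻¹) • y + (mu x t)⁻¹ • H x t := by
        simp only [H]
        rw [smul_add, smul_smul, inv_mul_cancel₀ (by linarith), one_smul, sub_smul, one_smul]
        abel
      rw [e]
      refine convex_closedBall c r ?_ h ?_ ?_ (by ring)
      · rw [Metric.mem_closedBall, dist_eq_norm]; exact hy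
      · have := inv_le_one_of_one_le₀ hm
        linarith
      · exact inv_nonneg.2 (by linarith)
  · intro x _
    simp [H, mu]
  · rintro x ⟨hx, hxy⟩
    refine ⟨(hB x ⟨hx, hxy⟩ 1).1, fun h => ?_⟩
    have hxy : x - y ≠ 0 := sub_ne_zero.2 hxy
    have hn : 0 < ‖x - y‖ := norm_pos_iff.2 hxy
    rw [Metric.mem_closedBall, dist_eq_norm] at h
    have h1 : mu x 1 = max 1 (3 * r / ‖x - y‖) := by simp [mu]
    have h2 : 3 * r ≤ mu x 1 * ‖x - y‖ := by
      rw [← div_le_iff₀ hn, h1]; exact le_max_right _ _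
    have h3 : mu x 1 • (x - y) = (H x 1 - c) - (y - c) := by simp only [H]; abel
    have h4 : mu x 1 * ‖x - y‖ ≤ r + r := by
      rw [← Real.norm_of_nonneg (show 0 ≤ mu x 1 by linarith [hmu x 1]), ← norm_smul, h3]
      exact (norm_sub_le _ _).trans (add_le_add h hy)
    linarith

/-! ### Charts -/
section
set_option linter.unusedSectionVars false
variable {V : Type} [TopologicalSpace V] [T2Space V]

theorem chart_exists {d : ℕ} (X : Set V) (hX : Nonempty (ChartedSpace (Eu d) X)) (v : V)
    (hv : v ∈ X) : ∃ (Q : ℝ) (c : Eu d) (g : Eu d → V) (h : V → Eu d), 0 < Q ∧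
      ContinuousOn g (Metric.ball c Q) ∧ Set.MapsTo g (Metric.ball c Q) X ∧ g c = v ∧
      (∀ y ∈ Metric.ball c Q, h (g y) = y) ∧ ContinuousOn h (g '' Metric.ball c Q) ∧
      (∀ W ⊆ Metric.ball c Q, IsOpen W → RO (g '' W) X) := by
  classical
  obtain ⟨inst⟩ := hX
  let e := chartAt (Eu d) (⟨v, hv⟩ : X)
  have hs : (⟨v, hv⟩ : X) ∈ e.source := mem_chart_source _ _
  obtain ⟨Q, hQ, hb⟩ := Metric.isOpen_iff.1 e.open_target (e ⟨v, hv⟩) (e.map_source hs)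
  let g : Eu d → V := fun y => (e.symm y : X).1
  let h : V → Eu d := fun x => if hx : x ∈ X then e ⟨x, hx⟩ else 0
  have hhX : ∀ x : X, h x.1 = e x := fun x => by simp [h]
  have hhg : ∀ y ∈ Metric.ball (e ⟨v, hv⟩) Q, h (g y) = y := fun y hy => by
    simp only [g]
    rw [hhX, e.right_inv (hb hy)]
  refine ⟨Q, e ⟨v, hv⟩, g, h, hQ, ?_, fun y _ => (e.symm y).2, ?_, hhg, ?_, ?_⟩
  · exact continuous_subtype_val.comp_continuousOn (e.continuousOn_symm.mono hb)
  · simp only [g]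
    rw [e.left_inv hs]
  · have hsub : ∀ x ∈ g '' Metric.ball (e ⟨v, hv⟩) Q, x ∈ X := by
      rintro _ ⟨y, _, rfl⟩; exact (e.symm y).2
    rw [continuousOn_iff_continuous_domRestrict]
    have : (g '' Metric.ball (e ⟨v, hv⟩) Q).domRestrict h = fun x => e ⟨x.1, hsub _ x.2⟩ := by
      funext x
      exact hhX ⟨x.1, hsub _ x.2⟩
    rw [this]
    refine e.continuousOn.comp_continuous (continuous_subtype_val.subtype_mk _) ?_
    rintro ⟨_, y, hy, rfl⟩
    exact e.map_target (hb hy)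
  · intro W hW hWo
    have h1 : IsOpen (e.symm '' W) := e.symm.isOpen_image_of_subset_source hWo (hW.trans hb)
    obtain ⟨O, hO, hOe⟩ := isOpen_induced_iff.1 h1
    refine ⟨O, hO, ?_⟩
    have : g '' W = Subtype.val '' (e.symm '' W) := by
      rw [Set.image_image]
    rw [this, ← hOe, Subtype.image_preimage_coe]

theorem manifold_point_rel {d : ℕ} (X : Set V) (hX : Nonempty (ChartedSpace (Eu d) X)) (v : V)
    (hv : v ∈ X) (j : ℕ) (hj : j + 1 ≤ d) : Rel j (X \ {v}) X := by
  obtain ⟨Q, c, g, h, hQ, hg, hgX, hgc, hhg, hh, hW⟩ := chart_exists X hX v hv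
  have hcQ := Metric.mem_ball_self (x := c) hQ
  have h1 : Rel j (g '' Metric.ball c Q \ {v}) (g '' Metric.ball c Q) := by
    refine Rel.transport Set.sdiff_subset Set.sdiff_subset g h hg hh (Set.mapsTo_image _ _) ?_
      ?_ ?_ ?_ (ball_rel c Q hQ j hj)
    · rintro y ⟨hy, hyc⟩
      refine ⟨⟨y, hy, rfl⟩, fun he => hyc ?_⟩
      have : g y = g c := by rw [hgc]; exact he
      rw [Set.mem_singleton_iff, ← hhg y hy, this, hhg c hcQ]
    · rintro _ ⟨y, hy, rfl⟩
      rwa [hhg y hy]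
    · rintro _ ⟨⟨y, hy, rfl⟩, hne⟩
      rw [hhg y hy]
      refine ⟨hy, ?_⟩
      rintro rfl
      exact hne hgc
    · rintro _ ⟨y, hy, rfl⟩
      rw [hhg y hy]
  have hUX : g '' Metric.ball c Q ⊆ X := hgX.image_subset
  have hu : (X \ {v}) ∪ g '' Metric.ball c Q = X := by
    refine Set.Subset.antisymm (Set.union_subset Set.sdiff_subset hUX) fun x hx => ?_
    by_cases hxv : x = v
    · right; rw [hxv, ← hgc]; exact ⟨c, hcQ, rfl⟩
    · exact Or.inl ⟨hx, hxv⟩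
  have hi : (X \ {v}) ∩ g '' Metric.ball c Q = g '' Metric.ball c Q \ {v} := by
    ext x; constructor
    · rintro ⟨a, b⟩; exact ⟨b, a.2⟩
    · rintro ⟨a, b⟩; exact ⟨⟨hUX a, b⟩, a⟩
  have := Rel.excision (A := X \ {v}) (B := g '' Metric.ball c Q) (j := j)
    (by rw [hu]; exact RO.of_closed isClosed_singleton)
    (by rw [hu]; exact hW _ subset_rfl Metric.isOpen_ball) (by rw [hi]; exact h1)
  rwa [hu] at this

theorem manifold_ball {d : ℕ} (X : Set V) (hX : Nonempty (ChartedSpace (Eu d) X)) (v : V)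
    (hv : v ∈ X) : ∃ (O D : Set V), IsOpen O ∧ v ∈ O ∧ X ∩ O ⊆ D ∧ D ⊆ X ∧
      ∀ p ∈ D, ARel (X \ D) (X \ {p}) := by
  obtain ⟨Q, c, g, h, hQ, hg, hgX, hgc, hhg, hh, hW⟩ := chart_exists X hX v hv
  have hcQ := Metric.mem_ball_self (x := c) hQ
  have hr : 0 < Q / 5 := by positivity
  have hsb : Metric.closedBall c (Q / 5) ⊆ Metric.ball c Q :=
    Metric.closedBall_subset_ball (by linarith)
  have hUX : g '' Metric.ball c Q ⊆ X := hgX.image_subset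
  obtain ⟨O, hO, hOe⟩ := hW (Metric.ball c (Q / 5)) (Metric.ball_subset_closedBall.trans hsb)
    Metric.isOpen_ball
  have hinj : ∀ y ∈ Metric.ball c Q, ∀ y' ∈ Metric.ball c Q, g y = g y' → y = y' := by
    intro y hy y' hy' he
    rw [← hhg y hy, he, hhg y' hy']
  refine ⟨O, g '' Metric.closedBall c (Q / 5), hO, ?_, ?_, ?_, ?_⟩
  · have : v ∈ g '' Metric.ball c (Q / 5) := ⟨c, Metric.mem_ball_self hr, hgc⟩
    rw [hOe] at this
    exact this.2
  · rw [← hOe]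
    exact Set.image_mono Metric.ball_subset_closedBall
  · exact (Set.image_mono hsb).trans hUX
  · rintro _ ⟨y, hy, rfl⟩ j
    set D := g '' Metric.closedBall c (Q / 5) with hD
    have hDc : IsClosed D :=
      ((isCompact_closedBall c (Q / 5)).image_of_continuousOn (hg.mono hsb)).isClosed
    have h1 : Rel j (g '' Metric.ball c Q \ D) (g '' Metric.ball c Q \ {g y}) := by
      have hs1 : Metric.ball c Q \ Metric.closedBall c (Q / 5) ⊆ Metric.ball c Q \ {y} := by
        rintro x ⟨a, b⟩; refine ⟨a, ?_⟩; rintro rfl; exact b hy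
      refine Rel.transport ?_ hs1 g h (hg.mono Set.sdiff_subset) (hh.mono Set.sdiff_subset) ?_ ?_
        ?_ ?_ ?_ (ball_push c y (Q / 5) Q hr (by linarith) hy j)
      · rintro x ⟨a, b⟩; refine ⟨a, ?_⟩; rintro rfl; exact b ⟨y, hy, rfl⟩
      · rintro x ⟨hx, hxy⟩
        exact ⟨⟨x, hx, rfl⟩, fun he => hxy (hinj _ hx _ (hsb hy) he)⟩
      · rintro x ⟨hx, hxy⟩
        refine ⟨⟨x, hx, rfl⟩, ?_⟩
        rintro ⟨x', hx', he⟩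
        rw [hinj _ (hsb hx') _ hx he] at hx'
        exact hxy hx'
      · rintro _ ⟨⟨x, hx, rfl⟩, hne⟩
        rw [hhg x hx]
        refine ⟨hx, ?_⟩
        rintro rfl
        exact hne rfl
      · rintro _ ⟨⟨x, hx, rfl⟩, hne⟩
        rw [hhg x hx]
        exact ⟨hx, fun h' => hne ⟨x, h', rfl⟩⟩
      · rintro _ ⟨⟨x, hx, rfl⟩, hne⟩
        rw [hhg x hx]
    have hgyD : g y ∈ D := ⟨y, hy, rfl⟩
    have hDU : D ⊆ g '' Metric.ball c Q := Set.image_mono hsb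
    have hu : (X \ D) ∪ (g '' Metric.ball c Q \ {g y}) = X \ {g y} := by
      ext x; constructor
      · rintro (⟨a, b⟩ | ⟨a, b⟩)
        · refine ⟨a, ?_⟩; rintro rfl; exact b hgyD
        · exact ⟨hUX a, b⟩
      · rintro ⟨a, b⟩
        by_cases hx : x ∈ D
        · exact Or.inr ⟨hDU hx, b⟩
        · exact Or.inl ⟨a, hx⟩
    have hi : (X \ D) ∩ (g '' Metric.ball c Q \ {g y}) = g '' Metric.ball c Q \ D := by
      ext x; constructor
      · rintro ⟨a, b⟩; exact ⟨b.1, a.2⟩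
      · rintro ⟨a, b⟩
        refine ⟨⟨hUX a, b⟩, a, ?_⟩
        rintro rfl; exact b hgyD
    have r1 : RO (X \ D) (X \ {g y}) := by
      refine (RO.of_closed hDc).mono ?_ Set.sdiff_subset
      rw [← hu]; exact Set.subset_union_left
    have r2 : RO (g '' Metric.ball c Q \ {g y}) (X \ {g y}) := by
      obtain ⟨O', hO', e'⟩ := hW _ subset_rfl Metric.isOpen_ball
      refine ⟨O', hO', ?_⟩
      rw [e']
      ext x
      simp only [Set.mem_sdiff, Set.mem_inter_iff]
      tauto
    have := Rel.excision (A := X \ D) (B := g '' Metric.ball c Q \ {g y}) (j := j)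
      (by rw [hu]; exact r1) (by rw [hu]; exact r2) (by rw [hi]; exact h1)
    rwa [hu] at this
end
end CubeDel

namespace CubeDel
/-! ### Cubical sets -/

theorem ARel.refl {V : Type} [TopologicalSpace V] (A : Set V) : ARel A A :=
  fun _ z hz _ => ⟨0, zero_mem _, by simpa using hz⟩

/-- Union of faces of the cube. -/
def CubeLike {n : ℕ} (X : Set (Fin n → ℝ)) : Prop :=
  (∀ x ∈ X, ∀ i, 0 ≤ x i ∧ x i ≤ 1) ∧
  ∀ x ∈ X, ∀ y : Fin n → ℝ, (∀ i, (0 ≤ y i ∧ y i ≤ 1) ∧ (x i = 0 → y i = 0) ∧ (x i = 1 → y i = 1)) →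
    y ∈ X

/-- Coordinate flat through `q`. -/
def Fl {n : ℕ} (T : Finset (Fin n)) (q : Fin n → ℝ) : Set (Fin n → ℝ) :=
  {x | ∀ l, l ∉ T → x l = q l}

theorem isClosed_Fl {n : ℕ} (T : Finset (Fin n)) (q : Fin n → ℝ) : IsClosed (Fl T q) := by
  have : Fl T q = ⋂ l, ⋂ (_ : l ∉ T), {x : Fin n → ℝ | x l = q l} := by
    ext x; simp [Fl]
  rw [this]
  exact isClosed_iInter fun l => isClosed_iInter fun _ => isClosed_eq (by fun_prop) continuous_const

theorem coord_scale {c s k : ℝ} (hc : c = 0 ∨ c = 1) (hs : 0 ≤ s ∧ s ≤ 1) (hk : 1 ≤ k)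
    (hks : k * |s - c| ≤ 1) :
    (0 ≤ c + (s - c) * k ∧ c + (s - c) * k ≤ 1) ∧ (s = 0 → c + (s - c) * k = 0) ∧
      (s = 1 → c + (s - c) * k = 1) := by
  rcases hc with rfl | rfl
  · rw [sub_zero, abs_of_nonneg hs.1] at hks
    refine ⟨⟨?_, ?_⟩, ?_, ?_⟩
    · have := mul_nonneg hs.1 (by linarith : 0 ≤ k); linarith
    · linarith
    · rintro rfl; ring
    · rintro rfl; linarith
  · rw [abs_of_nonpos (by linarith)] at hks
    refine ⟨⟨?_, ?_⟩, ?_, ?_⟩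
    · linarith
    · have := mul_nonneg (by linarith : 0 ≤ 1 - s) (by linarith : 0 ≤ k); linarith
    · rintro rfl; linarith
    · rintro rfl; ring

/-- Distance from the flat. -/
def dl {n : ℕ} (T : Finset (Fin n)) (q x : Fin n → ℝ) : ℝ := ∑ l ∈ Tᶜ, |x l - q l|

theorem dl_nonneg {n : ℕ} (T : Finset (Fin n)) (q x : Fin n → ℝ) : 0 ≤ dl T q x :=
  Finset.sum_nonneg fun _ _ => abs_nonneg _

theorem dl_eq_zero {n : ℕ} {T : Finset (Fin n)} {q x : Fin n → ℝ} : dl T q x = 0 ↔ x ∈ Fl T q := by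
  rw [dl, Finset.sum_eq_zero_iff_of_nonneg (fun _ _ => abs_nonneg _)]
  simp [Fl, sub_eq_zero]

theorem stretch {n : ℕ} {X : Set (Fin n → ℝ)} (hX : CubeLike X) (T : Finset (Fin n)) (i : Fin n)
    (hi : i ∈ T) (q : Fin n → ℝ) (c η : ℝ) (hc : c = 0 ∨ c = 1) (h0 : 0 < η) (h1 : η < 1) :
    ARel (X \ (Fl T q ∩ {x | |x i - c| ≤ η})) (X \ (Fl T q ∩ {x | x i = c})) := by
  let k : (Fin n → ℝ) → Set.Icc (0 : ℝ) 1 → ℝ := fun x t =>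
    1 + (t : ℝ) * ((1 + dl T q x) / (|x i - c| + dl T q x) - 1)
  let H : (Fin n → ℝ) → Set.Icc (0 : ℝ) 1 → (Fin n → ℝ) := fun x t =>
    Function.update x i (c + (x i - c) * k x t)
  have hFl : ∀ x t, H x t ∈ Fl T q ↔ x ∈ Fl T q := by
    intro x t
    refine forall_congr' fun l => imp_congr_right fun hl => ?_
    have : l ≠ i := by rintro rfl; exact hl hi
    simp [H, this]
  have hHi : ∀ x t, H x t i - c = (x i - c) * k x t := by
    intro x t; simp [H]
  have hpos : ∀ x ∈ X \ (Fl T q ∩ {x | x i = c}), 0 < |x i - c| + dl T q x := by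
    rintro x ⟨-, hx⟩
    by_cases hx' : x ∈ Fl T q
    · have : x i - c ≠ 0 := sub_ne_zero.2 fun e => hx ⟨hx', e⟩
      linarith [abs_pos.2 this, dl_nonneg T q x]
    · have : dl T q x ≠ 0 := fun e => hx' (dl_eq_zero.1 e)
      have := lt_of_le_of_ne (dl_nonneg T q x) this.symm
      linarith [abs_nonneg (x i - c)]
  have habs : ∀ x ∈ X, |x i - c| ≤ 1 := by
    intro x hx
    have := hX.1 x hx i
    rw [abs_le]
    rcases hc with rfl | rfl <;> constructor <;> linarith
  have hk1 : ∀ x ∈ X \ (Fl T q ∩ {x | x i = c}), ∀ t, 1 ≤ k x t := by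
    intro x hx t
    have h2 : 1 ≤ (1 + dl T q x) / (|x i - c| + dl T q x) := by
      rw [le_div_iff₀ (hpos x hx)]
      linarith [habs x hx.1]
    have := mul_nonneg t.2.1 (sub_nonneg.2 h2)
    simp only [k]
    linarith
  have hk2 : ∀ x ∈ X \ (Fl T q ∩ {x | x i = c}), ∀ t, k x t * |x i - c| ≤ 1 := by
    intro x hx t
    have hp := hpos x hx
    have ha := habs x hx.1
    have h2 : 1 ≤ (1 + dl T q x) / (|x i - c| + dl T q x) := by
      rw [le_div_iff₀ hp]
      linarith
    have h3 : k x t ≤ (1 + dl T q x) / (|x i - c| + dl T q x) := by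
      have := mul_le_of_le_one_left (sub_nonneg.2 h2) t.2.2
      simp only [k]
      linarith
    refine (mul_le_mul_of_nonneg_right h3 (abs_nonneg _)).trans ?_
    rw [div_mul_eq_mul_div, div_le_one hp]
    nlinarith [dl_nonneg T q x, abs_nonneg (x i - c)]
  have hHX : ∀ x ∈ X \ (Fl T q ∩ {x | x i = c}), ∀ t, H x t ∈ X := by
    intro x hx t
    refine hX.2 x hx.1 _ fun l => ?_
    by_cases hl : l = i
    · subst hl
      have := coord_scale hc (hX.1 x hx.1 l) (hk1 x hx t) (hk2 x hx t)
      simpa [H] using this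
    · simp only [H, Function.update_of_ne hl]
      exact ⟨hX.1 x hx.1 l, id, id⟩
  have hsub : X \ (Fl T q ∩ {x | |x i - c| ≤ η}) ⊆ X \ (Fl T q ∩ {x | x i = c}) := by
    rintro x ⟨a, b⟩
    refine ⟨a, fun h => b ⟨h.1, ?_⟩⟩
    have : x i = c := h.2
    show |x i - c| ≤ η
    rw [this]; simpa using h0.le
  refine ARel.of_homotopy hsub H ?_ ?_ ?_ ?_ ?_
  · have hdc : Continuous (dl T q) := by
      unfold dl; fun_prop
    have hkc : ContinuousOn (fun z : (Fin n → ℝ) × Set.Icc (0 : ℝ) 1 => k z.1 z.2)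
        ((X \ (Fl T q ∩ {x | x i = c})) ×ˢ Set.univ) := by
      have h3 : ContinuousOn (fun z : (Fin n → ℝ) × Set.Icc (0 : ℝ) 1 =>
          (1 + dl T q z.1) / (|z.1 i - c| + dl T q z.1))
          ((X \ (Fl T q ∩ {x | x i = c})) ×ˢ Set.univ) := by
        refine ContinuousOn.div (by fun_prop) (by fun_prop) ?_
        rintro ⟨x, t⟩ ⟨hx, -⟩
        exact (hpos x hx).ne'
      simp only [k]
      fun_prop
    refine continuousOn_pi.2 fun l => ?_
    by_cases hl : l = i
    · subst hl
      simp only [H, Function.update_self]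
      fun_prop
    · simp only [H, Function.update_of_ne hl]
      fun_prop
  · intro x hx t
    refine ⟨hHX x hx t, fun h => hx.2 ⟨(hFl x t).1 h.1, ?_⟩⟩
    have h2 : H x t i = c := h.2
    have h3 := hHi x t
    rw [h2, sub_self] at h3
    rcases mul_eq_zero.1 h3.symm with h4 | h4
    · exact sub_eq_zero.1 h4
    · linarith [hk1 x hx t]
  · intro x hx t
    refine ⟨hHX x (hsub hx) t, fun h => hx.2 ⟨(hFl x t).1 h.1, ?_⟩⟩
    have h2 : |H x t i - c| ≤ η := h.2
    have h5 := hk1 x (hsub hx) t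
    rw [hHi, abs_mul, abs_of_nonneg (by linarith : 0 ≤ k x t)] at h2
    show |x i - c| ≤ η
    nlinarith [abs_nonneg (x i - c)]
  · intro x _
    simp [H, k]
  · intro x hx
    refine ⟨hHX x hx 1, fun h => ?_⟩
    have h2 : |H x 1 i - c| ≤ η := h.2
    have h3 : dl T q x = 0 := dl_eq_zero.2 ((hFl x 1).1 h.1)
    have hp := hpos x hx
    have hk : k x 1 = 1 / |x i - c| := by simp [k, h3]
    rw [h3, add_zero] at hp
    rw [hHi, abs_mul, hk, abs_of_nonneg (one_div_nonneg.2 hp.le), mul_one_div, div_self hp.ne'] at h2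
    linarith

theorem flat_rel {n d : ℕ} {X : Set (Fin n → ℝ)} (hX : CubeLike X)
    (hch : Nonempty (ChartedSpace (Eu d) X)) (T : Finset (Fin n)) :
    ∀ q : Fin n → ℝ, (∀ i, 0 ≤ q i ∧ q i ≤ 1) → (∀ i ∈ T, q i = 1) →
      (∀ x ∈ Fl T q, (∀ i, 0 ≤ x i ∧ x i ≤ 1) → x ∈ X) → ARel (X \ Fl T q) (X \ {q}) := by
  induction T using Finset.induction_on with
  | empty =>
    intro q _ _ _
    have : Fl ∅ q = {q} := by
      ext x; simp [Fl, funext_iff]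
    rw [this]
    exact ARel.refl _
  | insert i T hi ih =>
    intro q hq hqT hF
    have hqi : q i = 1 := hqT i (Finset.mem_insert_self _ _)
    -- facts about the moved base points
    have hFl : ∀ s : ℝ, Fl T (Function.update q i s) = Fl (insert i T) q ∩ {x | x i = s} := by
      intro s
      ext x
      simp only [Fl, Set.mem_inter_iff, Set.mem_ofPred_eq, Finset.mem_insert]
      constructor
      · intro h
        refine ⟨fun l hl => ?_, ?_⟩
        · push Not at hl
          simpa [hl.1] using h l hl.2
        · simpa using h i hi
      · rintro ⟨h1, h2⟩ l hl
        by_cases hli : l = i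
        · subst hli; simpa using h2
        · simpa [hli] using h1 l (by push Not; exact ⟨hli, hl⟩)
    have hFl1 : ∀ s : ℝ, Fl {i} q ∩ {x | x i = s} = {Function.update q i s} := by
      intro s
      ext x
      simp only [Fl, Set.mem_inter_iff, Set.mem_ofPred_eq, Finset.mem_singleton,
        Set.mem_singleton_iff]
      constructor
      · rintro ⟨h1, h2⟩
        funext l
        by_cases hli : l = i
        · subst hli; simpa using h2
        · simpa [hli] using h1 l hli
      · rintro rfl
        exact ⟨fun l hl => by simp [hl], by simp⟩
    have hself : ∀ (U : Finset (Fin n)) (p : Fin n → ℝ), p ∈ Fl U p := fun U p l _ => rfl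
    have hup : ∀ s : ℝ, 0 ≤ s → s ≤ 1 → ∀ l, 0 ≤ Function.update q i s l ∧ Function.update q i s l ≤ 1 := by
      intro s h0 h1 l
      by_cases hli : l = i
      · subst hli; simpa using ⟨h0, h1⟩
      · simpa [hli] using hq l
    have hupX : ∀ s : ℝ, 0 ≤ s → s ≤ 1 → Function.update q i s ∈ X := by
      intro s h0 h1
      refine hF _ ?_ (hup s h0 h1)
      have := hself T (Function.update q i s)
      rw [hFl] at this
      exact this.1
    have hIH : ∀ s : ℝ, 0 ≤ s → s ≤ 1 →
        ARel (X \ (Fl (insert i T) q ∩ {x | x i = s})) (X \ {Function.update q i s}) := by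
      intro s h0 h1
      rw [← hFl]
      refine ih _ (hup s h0 h1) ?_ ?_
      · intro l hl
        have : l ≠ i := by rintro rfl; exact hi hl
        simpa [this] using hqT l (Finset.mem_insert_of_mem hl)
      · intro x hx
        rw [hFl] at hx
        exact hF x hx.1
    have hsing : ∀ s : ℝ, Function.update q i s ∈ Fl (insert i T) q ∩ {x | x i = s} := by
      intro s
      rw [← hFl]
      exact hself _ _
    -- the chart ball
    obtain ⟨O, D, hO, hqO, hOD, hDX, hD⟩ := manifold_ball X hch _ (hupX 0 le_rfl zero_le_one)
    obtain ⟨ε, hε0, hε1, hεO⟩ : ∃ ε : ℝ, 0 < ε ∧ ε < 1 ∧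
        ∀ s, |s - 0| ≤ ε → Function.update q i s ∈ O := by
      have hcont : Continuous (fun s : ℝ => Function.update q i s) := by fun_prop
      obtain ⟨ρ, hρ, h⟩ := Metric.isOpen_iff.1 (hO.preimage hcont) 0 hqO
      refine ⟨min (ρ / 2) (1 / 2), by positivity, ?_, fun s hs => h ?_⟩
      · exact (min_le_right _ _).trans_lt (by norm_num)
      · rw [Metric.mem_ball, Real.dist_eq]
        have := hs.trans (min_le_left _ _)
        linarith
    set Q := Fl (insert i T) q with hQ
    set Q0 := Q ∩ {x | |x i - 0| ≤ ε} with hQ0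
    set Q1 := Q ∩ {x | |x i - 1| ≤ 1 - ε} with hQ1
    set J := Fl {i} q ∩ {x | |x i - 0| ≤ ε} with hJ
    have hJQ0 : J ⊆ Q0 := by
      rintro x ⟨h1, h2⟩
      refine ⟨fun l hl => h1 l ?_, h2⟩
      rw [Finset.mem_insert] at hl
      push Not at hl
      simpa using hl.1
    have hJD : ∀ x ∈ X, x ∈ J → x ∈ D := by
      rintro x hx ⟨h1, h2⟩
      refine hOD ⟨hx, ?_⟩
      have : x ∈ Fl {i} q ∩ {y | y i = x i} := ⟨h1, rfl⟩
      rw [hFl1] at this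
      rw [this]
      exact hεO _ h2
    have huJ : ∀ s : ℝ, |s - 0| ≤ ε → Function.update q i s ∈ J := by
      intro s hs
      have : Function.update q i s ∈ Fl {i} q ∩ {y | y i = s} := by rw [hFl1]; rfl
      refine ⟨this.1, ?_⟩
      have h2 : Function.update q i s i = s := this.2
      show |Function.update q i s i - 0| ≤ ε
      rwa [h2]
    have hεε : |ε - 0| ≤ ε := by rw [sub_zero, abs_of_pos hε0]
    have h0ε : |(0 : ℝ) - 0| ≤ ε := by simpa using hε0.le
    have sa := stretch hX (insert i T) i (Finset.mem_insert_self _ _) q 0 ε (Or.inl rfl) hε0 hε1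
    have sb := stretch hX {i} i (Finset.mem_singleton_self _) q 0 ε (Or.inl rfl) hε0 hε1
    have sh := stretch hX (insert i T) i (Finset.mem_insert_self _ _) q 1 (1 - ε) (Or.inr rfl)
      (by linarith) (by linarith)
    rw [hFl1] at sb
    rw [← hQ, ← hQ0] at sa
    rw [← hQ, ← hQ1] at sh
    rw [← hJ] at sb
    have c0 := hD _ (hJD _ (hupX 0 le_rfl zero_le_one) (huJ 0 h0ε))
    have c1 := hD _ (hJD _ (hupX ε hε0.le hε1.le) (huJ ε hεε))
    have sDJ : X \ D ⊆ X \ J := fun x hx => ⟨hx.1, fun h => hx.2 (hJD x hx.1 h)⟩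
    have sJ : ∀ s : ℝ, |s - 0| ≤ ε → X \ J ⊆ X \ {Function.update q i s} := by
      intro s hs
      refine Set.sdiff_subset_sdiff_right ?_
      rw [Set.singleton_subset_iff]
      exact huJ s hs
    have d1 := ARel.left sDJ (sJ 0 h0ε) c0 sb
    have d2 := ARel.right sDJ (sJ ε hεε) c1 d1
    have sQJ : X \ Q0 ⊆ X \ J := Set.sdiff_subset_sdiff_right hJQ0
    have sP : ∀ s : ℝ, X \ (Q ∩ {x | x i = s}) ⊆ X \ {Function.update q i s} := by
      intro s
      refine Set.sdiff_subset_sdiff_right ?_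
      rw [Set.singleton_subset_iff]
      exact hsing s
    have sQ0 : ∀ s : ℝ, |s - 0| ≤ ε → X \ Q0 ⊆ X \ (Q ∩ {x | x i = s}) := by
      intro s hs
      refine Set.sdiff_subset_sdiff_right ?_
      rintro x ⟨h1, h2⟩
      have h2 : x i = s := h2
      refine ⟨h1, ?_⟩
      show |x i - 0| ≤ ε
      rwa [h2]
    have e1 := ARel.trans (sQ0 0 h0ε) (sP 0) sa (hIH 0 le_rfl zero_le_one)
    have e2 := ARel.left sQJ (sJ 0 h0ε) e1 sb
    have e3 := ARel.trans sQJ (sJ ε hεε) e2 d2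
    have f1 := ARel.left (sQ0 ε hεε) (sP ε) e3 (hIH ε hε0.le hε1.le)
    have hu : (X \ Q0) ∪ (X \ Q1) = X \ (Q ∩ {x | x i = ε}) := by
      rw [← Set.sdiff_inter]
      congr 1
      ext x
      constructor
      · rintro ⟨⟨h1, h2⟩, -, h3⟩
        refine ⟨h1, ?_⟩
        have h2 : |x i - 0| ≤ ε := h2
        have h3 : |x i - 1| ≤ 1 - ε := h3
        rw [abs_le] at h2 h3
        show x i = ε
        linarith
      · rintro ⟨h1, h2⟩
        have h2 : x i = ε := h2
        refine ⟨⟨h1, ?_⟩, h1, ?_⟩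
        · show |x i - 0| ≤ ε
          rw [h2]; exact hεε
        · show |x i - 1| ≤ 1 - ε
          rw [h2, abs_le]; constructor <;> linarith
    have hinter : (X \ Q0) ∩ (X \ Q1) = X \ Q := by
      ext x
      constructor
      · rintro ⟨⟨hx, h1⟩, -, h2⟩
        refine ⟨hx, fun h => ?_⟩
        have hxi := hX.1 x hx i
        rcases le_total (x i) ε with h3 | h3
        · refine h1 ⟨h, ?_⟩
          show |x i - 0| ≤ ε
          rw [abs_le]; constructor <;> linarith
        · refine h2 ⟨h, ?_⟩
          show |x i - 1| ≤ 1 - ε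
          rw [abs_le]; constructor <;> linarith
      · rintro ⟨hx, h⟩
        exact ⟨⟨hx, fun h' => h h'.1⟩, hx, fun h' => h h'.1⟩
    have cQ0 : IsClosed Q0 := (isClosed_Fl _ _).inter (isClosed_le (by fun_prop) (by fun_prop))
    have cQ1 : IsClosed Q1 := (isClosed_Fl _ _).inter (isClosed_le (by fun_prop) (by fun_prop))
    have g1 : ARel (X \ Q) (X \ Q1) := by
      intro j
      have := Rel.excision' (A := X \ Q0) (B := X \ Q1) (j := j)
        ((RO.of_closed cQ0).mono Set.subset_union_left
          (Set.union_subset Set.sdiff_subset Set.sdiff_subset))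
        ((RO.of_closed cQ1).mono Set.subset_union_right
          (Set.union_subset Set.sdiff_subset Set.sdiff_subset))
        (by rw [hu]; exact f1 j)
      rwa [hinter] at this
    have hq1 : Function.update q i 1 = q := by
      rw [← hqi]; exact Function.update_eq_self i q
    have s1 : X \ Q ⊆ X \ Q1 := Set.sdiff_subset_sdiff_right Set.inter_subset_left
    have s2 : X \ Q1 ⊆ X \ (Q ∩ {x | x i = 1}) := by
      refine Set.sdiff_subset_sdiff_right ?_
      rintro x ⟨h1, h2⟩
      have h2 : x i = 1 := h2
      refine ⟨h1, ?_⟩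
      show |x i - 1| ≤ 1 - ε
      rw [h2]; simp; exact hε1.le
    have k1 := ARel.trans s1 s2 g1 sh
    have k2 := ARel.trans (s1.trans s2) (sP 1) k1 (hIH 1 zero_le_one le_rfl)
    rwa [hq1] at k2

theorem deform {n : ℕ} {X : Set (Fin n → ℝ)} (hX : CubeLike X) (T : Finset (Fin n))
    (q : Fin n → ℝ) (hq : ∀ l, l ∉ T → q l = 0 ∨ q l = 1) :
    ARel {x | x ∈ X ∧ ∃ l, l ∉ T ∧ |x l - q l| = 1} (X \ Fl T q) := by
  let f : (Fin n → ℝ) → (Fin n → ℝ) := fun x l => if l ∈ T then 0 else x l - q l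
  have hfc : Continuous f := by
    refine continuous_pi fun l => ?_
    by_cases hl : l ∈ T
    · simp only [f, hl, if_true]; fun_prop
    · simp only [f, hl, if_false]; fun_prop
  have hfl : ∀ x l, l ∉ T → f x l = x l - q l := fun x l hl => by simp [f, hl]
  have hpos : ∀ x ∈ X \ Fl T q, 0 < ‖f x‖ := by
    rintro x ⟨-, hx⟩
    rw [norm_pos_iff]
    intro h
    refine hx fun l hl => ?_
    have := congrFun h l
    rw [hfl x l hl] at this
    exact sub_eq_zero.1 this
  have habs : ∀ x ∈ X, ∀ l, l ∉ T → |x l - q l| ≤ 1 := by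
    intro x hx l hl
    have := hX.1 x hx l
    rw [abs_le]
    rcases hq l hl with h | h <;> rw [h] <;> constructor <;> linarith
  have hle1 : ∀ x ∈ X, ‖f x‖ ≤ 1 := by
    intro x hx
    refine (pi_norm_le_iff_of_nonneg zero_le_one).2 fun l => ?_
    by_cases hl : l ∈ T
    · simp [f, hl]
    · rw [hfl x l hl]; exact habs x hx l hl
  let k : (Fin n → ℝ) → Set.Icc (0 : ℝ) 1 → ℝ := fun x t => 1 + (t : ℝ) * (‖f x‖⁻¹ - 1)
  let H : (Fin n → ℝ) → Set.Icc (0 : ℝ) 1 → (Fin n → ℝ) := fun x t l =>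
    if l ∈ T then x l else q l + (x l - q l) * k x t
  have hHl : ∀ x t l, l ∉ T → H x t l = q l + (x l - q l) * k x t := fun x t l hl => by
    simp [H, hl]
  have hk1 : ∀ x ∈ X \ Fl T q, ∀ t, 1 ≤ k x t := by
    intro x hx t
    have := one_le_inv_iff₀.2 ⟨hpos x hx, hle1 x hx.1⟩
    have := mul_nonneg t.2.1 (sub_nonneg.2 this)
    simp only [k]; linarith
  have hk2 : ∀ x ∈ X \ Fl T q, ∀ t, ∀ l, l ∉ T → k x t * |x l - q l| ≤ 1 := by
    intro x hx t l hl
    have h2 := one_le_inv_iff₀.2 ⟨hpos x hx, hle1 x hx.1⟩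
    have h3 : k x t ≤ ‖f x‖⁻¹ := by
      have := mul_le_of_le_one_left (sub_nonneg.2 h2) t.2.2
      simp only [k]; linarith
    have h4 : |x l - q l| ≤ ‖f x‖ := by
      have := norm_le_pi_norm (f x) l
      rwa [hfl x l hl] at this
    calc k x t * |x l - q l| ≤ ‖f x‖⁻¹ * ‖f x‖ :=
          mul_le_mul h3 h4 (abs_nonneg _) (inv_nonneg.2 (norm_nonneg _))
      _ = 1 := inv_mul_cancel₀ (hpos x hx).ne'
  have hHX : ∀ x ∈ X \ Fl T q, ∀ t, H x t ∈ X := by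
    intro x hx t
    refine hX.2 x hx.1 _ fun l => ?_
    by_cases hl : l ∈ T
    · simp only [H, hl, if_true]
      exact ⟨hX.1 x hx.1 l, id, id⟩
    · rw [hHl x t l hl]
      exact coord_scale (hq l hl) (hX.1 x hx.1 l) (hk1 x hx t) (hk2 x hx t l hl)
  have hsub : {x | x ∈ X ∧ ∃ l, l ∉ T ∧ |x l - q l| = 1} ⊆ X \ Fl T q := by
    rintro x ⟨hx, l, hl, h⟩
    refine ⟨hx, fun h' => ?_⟩
    rw [h' l hl] at h
    simp at h
  refine ARel.of_homotopy hsub H ?_ ?_ ?_ ?_ ?_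
  · have h3 : ContinuousOn (fun z : (Fin n → ℝ) × Set.Icc (0 : ℝ) 1 => ‖f z.1‖⁻¹)
        ((X \ Fl T q) ×ˢ Set.univ) := by
      refine ContinuousOn.inv₀ (by fun_prop) ?_
      rintro ⟨x, t⟩ ⟨hx, -⟩
      exact (hpos x hx).ne'
    refine continuousOn_pi.2 fun l => ?_
    by_cases hl : l ∈ T
    · simp only [H, hl, if_true]; fun_prop
    · simp only [H, hl, if_false, k]; fun_prop
  · intro x hx t
    refine ⟨hHX x hx t, fun h => hx.2 fun l hl => ?_⟩
    have h2 := h l hl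
    rw [hHl x t l hl] at h2
    have h3 : (x l - q l) * k x t = 0 := by linarith
    rcases mul_eq_zero.1 h3 with h4 | h4
    · exact sub_eq_zero.1 h4
    · linarith [hk1 x hx t]
  · rintro x hx t
    have hx' := hsub hx
    obtain ⟨-, l, hl, h⟩ := hx
    refine ⟨hHX x hx' t, l, hl, ?_⟩
    rw [hHl x t l hl, add_sub_cancel_left, abs_mul, h, one_mul]
    have h2 := hk2 x hx' t l hl
    have h3 := hk1 x hx' t
    rw [h] at h2
    rw [abs_of_nonneg (by linarith)]
    linarith
  · intro x _
    funext l
    simp [H, k]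
  · intro x hx
    refine ⟨hHX x hx 1, ?_⟩
    by_contra hcon
    push Not at hcon
    have hp := hpos x hx
    have hk : k x 1 = ‖f x‖⁻¹ := by simp [k]
    have : ‖f x‖ < ‖f x‖ := by
      refine (pi_norm_lt_iff hp).2 fun l => ?_
      by_cases hl : l ∈ T
      · simpa [f, hl] using hp
      · have h2 := hcon l hl
        rw [hHl x 1 l hl, add_sub_cancel_left, abs_mul, hk, abs_of_pos (inv_pos.2 hp)] at h2
        refine lt_of_le_of_ne (norm_le_pi_norm (f x) l) fun h => h2 ?_
        rw [← Real.norm_eq_abs, ← hfl x l hl, h, mul_inv_cancel₀ hp.ne']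
    exact lt_irrefl _ this
end CubeDel

namespace CubeDel
/-! ### Application to cubical complexes -/
open CubeFace

theorem cubeLike_real {n : ℕ} (M : Set (CubeFace n)) : CubeLike (real M) := by
  constructor
  · intro x hx
    simp only [real, Set.mem_iUnion] at hx
    obtain ⟨F, _, hx, _⟩ := hx
    exact hx
  · intro x hx y hy
    simp only [real, Set.mem_iUnion] at hx ⊢
    obtain ⟨F, hF, _, hx⟩ := hx
    exact ⟨F, hF, fun i => (hy i).1, fun i => ⟨fun h => (hy i).2.1 ((hx i).1 h),
      fun h => (hy i).2.2 ((hx i).2 h)⟩⟩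

/-- The free coordinates of a face. -/
noncomputable def freeC {n : ℕ} (F : CubeFace n) : Finset (Fin n) := by
  classical exact Finset.univ.filter (fun i => F i = none)

theorem mem_freeC {n : ℕ} {F : CubeFace n} {i : Fin n} : i ∈ freeC F ↔ F i = none := by
  classical simp [freeC]

/-- The top vertex of a face. -/
def topV {n : ℕ} (F : CubeFace n) : Fin n → ℝ := fun i => if F i = some false then 0 else 1

theorem mem_cvert_bdryHat {n : ℕ} {F : CubeFace n} (h : (freeC F).Nonempty) (v : Fin n → Bool) :
    v ∈ cvert (bdryHat F) ↔ ∀ i, F i = none ∨ some (v i) = F i := by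
  constructor
  · intro hv
    exact hv.1
  · intro hv
    refine ⟨hv, ?_⟩
    obtain ⟨i, hi⟩ := h
    rw [mem_freeC] at hi
    intro e
    have := congrFun e i
    rw [hi] at this
    exact Option.some_ne_none _ this

theorem real_delete {n : ℕ} {M : Set (CubeFace n)} (hM : IsSubcomplex M) {F : CubeFace n}
    (h : (freeC F).Nonempty) :
    real (delete M (bdryHat F)) =
      {x | x ∈ real M ∧ ∃ l, l ∉ freeC F ∧ |x l - topV F l| = 1} := by
  ext x
  constructor
  · intro hx
    simp only [real, Set.mem_iUnion] at hx
    obtain ⟨G, ⟨hGM, hG⟩, hx1, hx2⟩ := hx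
    refine ⟨?_, ?_⟩
    · simp only [real, Set.mem_iUnion]
      exact ⟨G, hGM, hx1, hx2⟩
    · by_contra hcon
      push Not at hcon
      let v : Fin n → Bool := fun l => ((F l).or (G l)).getD false
      have hv : v ∈ verts G ∩ cvert (bdryHat F) := by
        refine ⟨fun l => ?_, (mem_cvert_bdryHat h v).2 fun l => ?_⟩
        · show G l = none ∨ some (v l) = G l
          have hl := hcon l
          rw [mem_freeC] at hl
          have h2 := hx2 l
          simp only [v, topV] at hl ⊢
          rcases hF : F l with _ | _ | _ <;> rcases hG : G l with _ | _ | _ <;>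
            simp_all
        · rcases hF : F l with _ | _ | _ <;> simp [v, hF]
      rw [hG] at hv
      exact hv
  · rintro ⟨hx, l, hl, hxl⟩
    simp only [real, Set.mem_iUnion] at hx ⊢
    obtain ⟨G, hGM, hx1, hx2⟩ := hx
    rw [mem_freeC] at hl
    obtain ⟨b, hb⟩ := Option.ne_none_iff_exists'.1 hl
    have h01 := hx1 l
    have hxb : (b = false → x l = 1) ∧ (b = true → x l = 0) := by
      constructor
      · rintro rfl
        simp only [topV, hb, if_true, sub_zero] at hxl
        rwa [abs_of_nonneg h01.1] at hxl
      · rintro rfl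
        simp only [topV, hb] at hxl
        rw [if_neg (by simp), abs_of_nonpos (by linarith)] at hxl
        linarith
    let G' : CubeFace n := Function.update (β := fun _ => Option Bool) G l (some (!b))
    have hG'l : G' l = some (!b) := Function.update_self ..
    have hG'm : ∀ m, m ≠ l → G' m = G m := fun m hm => Function.update_of_ne hm ..
    refine ⟨G', ⟨hM.2 G hGM G' fun m => ?_, ?_⟩, hx1, fun m => ?_⟩
    · by_cases hm : m = l
      · subst hm
        rw [hG'l]
        have h2 := hx2 m
        rcases hG : G m with _ | c
        · exact Or.inl rfl
        · right
          cases b <;> cases c <;> simp_all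
      · right; exact hG'm m hm
    · rw [Set.eq_empty_iff_forall_notMem]
      rintro v ⟨h1, h2⟩
      rw [mem_cvert_bdryHat h] at h2
      have h3 : G' l = none ∨ some (v l) = G' l := h1 l
      have h4 := h2 l
      rw [hG'l] at h3
      rw [hb] at h4
      cases b <;> simp_all
    · by_cases hm : m = l
      · subst hm
        rw [hG'l]
        cases b <;> simp_all
      · rw [hG'm m hm]; exact hx2 m

theorem main_rel {n d : ℕ} {M : Set (CubeFace n)} (hM : IsSubcomplex M)
    (hch : Nonempty (ChartedSpace (EuclideanSpace ℝ (Fin d)) (real M))) {F : CubeFace n}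
    (hF : F ∈ M) (h : (freeC F).Nonempty) (j : ℕ) (hj : j + 1 ≤ d) :
    Rel j (real (delete M (bdryHat F))) (real M) := by
  have hX := cubeLike_real M
  have hfull : ∀ x ∈ Fl (freeC F) (topV F), (∀ i, 0 ≤ x i ∧ x i ≤ 1) → x ∈ real M := by
    intro x hx h01
    simp only [real, Set.mem_iUnion]
    refine ⟨F, hF, h01, fun i => ⟨fun hi => ?_, fun hi => ?_⟩⟩
    · rw [hx i (by rw [mem_freeC, hi]; simp)]; simp [topV, hi]
    · rw [hx i (by rw [mem_freeC, hi]; simp)]; simp [topV, hi]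
  have h01 : ∀ i, 0 ≤ topV F i ∧ topV F i ≤ 1 := by
    intro i; unfold topV; split_ifs <;> norm_num
  have h1 := flat_rel hX hch (freeC F) (topV F) h01 (fun i hi => by
    rw [mem_freeC] at hi; simp [topV, hi]) hfull j
  have hq : topV F ∈ real M := hfull _ (fun _ _ => rfl) h01
  have h2 := manifold_point_rel (real M) hch (topV F) hq j hj
  have h3 := deform hX (freeC F) (topV F) (fun l _ => by
    unfold topV; split_ifs
    · exact Or.inl rfl
    · exact Or.inr rfl) j
  rw [← real_delete hM h] at h3
  have s1 : real M \ Fl (freeC F) (topV F) ⊆ real M \ {topV F} := by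
    refine Set.sdiff_subset_sdiff_right ?_
    rw [Set.singleton_subset_iff]
    exact fun _ _ => rfl
  have s2 : real (delete M (bdryHat F)) ⊆ real M \ Fl (freeC F) (topV F) := by
    rw [real_delete hM h]
    rintro x ⟨hx, l, hl, h⟩
    refine ⟨hx, fun h' => ?_⟩
    rw [h' l hl] at h
    simp at h
  exact h3.trans s2 Set.sdiff_subset (h1.trans s1 Set.sdiff_subset h2)
end CubeDel

namespace CubeDel
open CategoryTheory HomologicalComplex

theorem cyc_exists (K : ChainComplex (ModuleCat.{0} R) ℕ) (j k : ℕ) (hj : (ComplexShape.down ℕ).next j = k)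
    (z : K.X j) (hz : K.d j k z = 0) : ∃ c : K.cycles j, K.iCycles j c = z := by
  have h := ShortComplex.exact_of_f_is_kernel
    (ShortComplex.mk (K.iCycles j) (K.d j k) (K.iCycles_d j k)) (K.cyclesIsKernel j k hj)
  exact (ShortComplex.moduleCat_exact_iff _).1 h z hz

theorem bd_exists (K : ChainComplex (ModuleCat.{0} R) ℕ) (i j : ℕ) (hi : (ComplexShape.down ℕ).prev j = i)
    (c : K.cycles j) (hz : K.homologyπ j c = 0) : ∃ w : K.X i, K.toCycles i j w = c := by
  have h := ShortComplex.exact_of_g_is_cokernel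
    (ShortComplex.mk (K.toCycles i j) (K.homologyπ j) (K.toCycles_comp_homologyπ i j))
    (K.homologyIsCokernel i j hi)
  exact (ShortComplex.moduleCat_exact_iff _).1 h c hz

theorem iCycles_inj (K : ChainComplex (ModuleCat.{0} R) ℕ) (j : ℕ) :
    Function.Injective (K.iCycles j) := (ModuleCat.mono_iff_injective _).1 inferInstance

theorem pi_surj (K : ChainComplex (ModuleCat.{0} R) ℕ) (j : ℕ) :
    Function.Surjective (K.homologyπ j) := (ModuleCat.epi_iff_surjective _).1 inferInstance

theorem iso_of {K L : ChainComplex (ModuleCat.{0} R) ℕ} (φ : K ⟶ L) (i j k : ℕ)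
    (hi : (ComplexShape.down ℕ).prev j = i) (hj : (ComplexShape.down ℕ).next j = k)
    (hs : ∀ z : L.X j, L.d j k z = 0 → ∃ y : K.X j, K.d j k y = 0 ∧
      ∃ w : L.X i, z = φ.f j y + L.d i j w)
    (hinj : ∀ y : K.X j, K.d j k y = 0 → ∀ w : L.X i, φ.f j y = L.d i j w →
      ∃ u : K.X i, y = K.d i j u) :
    Nonempty (K.homology j ≅ L.homology j) := by
  have hbz : ∀ (K : ChainComplex (ModuleCat.{0} R) ℕ) (w : K.X i),
      K.homologyπ j (K.toCycles i j w) = 0 := by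
    intro K w
    have := ConcreteCategory.congr_hom (K.toCycles_comp_homologyπ i j) w
    exact this
  have htc : ∀ (K : ChainComplex (ModuleCat.{0} R) ℕ) (w : K.X i),
      K.iCycles j (K.toCycles i j w) = K.d i j w := by
    intro K w
    have := ConcreteCategory.congr_hom (K.toCycles_i i j) w
    exact this
  have hcm : ∀ c : K.cycles j, L.iCycles j (cyclesMap φ j c) = φ.f j (K.iCycles j c) := by
    intro c
    have := ConcreteCategory.congr_hom (cyclesMap_i φ j) c
    exact this
  have hπ : ∀ c : K.cycles j, homologyMap φ j (K.homologyπ j c) =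
      L.homologyπ j (cyclesMap φ j c) := by
    intro c
    have := ConcreteCategory.congr_hom (homologyπ_naturality φ j) c
    exact this
  have hid : ∀ (K : ChainComplex (ModuleCat.{0} R) ℕ) (c : K.cycles j),
      K.d j k (K.iCycles j c) = 0 := by
    intro K c
    have := ConcreteCategory.congr_hom (K.iCycles_d j k) c
    exact this
  have hb : Function.Bijective (homologyMap φ j) := by
    constructor
    · rw [injective_iff_map_eq_zero]
      intro a ha
      obtain ⟨c, rfl⟩ := pi_surj K j a
      rw [hπ] at ha
      obtain ⟨w, hw⟩ := bd_exists L i j hi _ ha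
      obtain ⟨u, hu⟩ := hinj (K.iCycles j c) (hid K c) w (by rw [← hcm, ← hw, htc])
      have : c = K.toCycles i j u := iCycles_inj K j (by rw [hu, htc])
      rw [this, hbz]
    · intro a
      obtain ⟨c, rfl⟩ := pi_surj L j a
      obtain ⟨y, hy, w, hw⟩ := hs (L.iCycles j c) (hid L c)
      obtain ⟨e, rfl⟩ := cyc_exists K j k hj y hy
      refine ⟨K.homologyπ j e, ?_⟩
      have : c = cyclesMap φ j e + L.toCycles i j w :=
        iCycles_inj L j (by rw [hw, map_add, htc, hcm])
      rw [hπ, this, map_add, hbz, add_zero]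
  exact ⟨(LinearEquiv.ofBijective (homologyMap φ j).hom hb).toModuleIso⟩

open Finsupp Opposite

/-- The singular chain complex of a subset. -/
noncomputable abbrev SC {V : Type} [TopologicalSpace V] (A : Set V) :
    ChainComplex (ModuleCat.{0} R) ℕ :=
  (AlgebraicTopology.alternatingFaceMapComplex (ModuleCat R)).obj
    (((SimplicialObject.whiskering _ _).obj (ModuleCat.free R)).obj
      (TopCat.toSSet.obj (TopCat.of A)))

/-- The chain map induced by an inclusion. -/
noncomputable def SCi {V : Type} [TopologicalSpace V] {A B : Set V} (h : A ⊆ B) :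
    SC A ⟶ SC B :=
  (AlgebraicTopology.alternatingFaceMapComplex (ModuleCat R)).map
    (((SimplicialObject.whiskering _ _).obj (ModuleCat.free R)).map
      (TopCat.toSSet.map (TopCat.ofHom ⟨Set.inclusion h, continuous_inclusion h⟩)))

variable {V : Type} [TopologicalSpace V] 

/-- The simplices. -/
abbrev Sing (A : Set V) (m : ℕ) : Type :=
  (TopCat.toSSet.obj (TopCat.of A)).obj (op (SimplexCategory.mk m))

/-- Underlying map of a singular simplex. -/
noncomputable def und (A : Set V) (m : ℕ) (s : Sing A m) : Δ (m + 1) → V :=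
  fun x => ((TopCat.toSSetObjEquiv (TopCat.of A) (op (SimplexCategory.mk m)) s : C(_, _)) x : A).1

theorem und_inj (A : Set V) (m : ℕ) : Function.Injective (und A m) := by
  intro s t h
  apply (TopCat.toSSetObjEquiv (TopCat.of A) (op (SimplexCategory.mk m))).injective
  ext x
  exact congrFun h x

theorem und_mem (A : Set V) (m : ℕ) (s : Sing A m) : und A m s ∈ Spx A (m + 1) := by
  refine ⟨?_, fun x => Subtype.coe_prop _⟩
  exact continuous_subtype_val.comp (ContinuousMap.continuous _)

theorem und_surj (A : Set V) (m : ℕ) (σ) (hσ : σ ∈ Spx A (m + 1)) : ∃ s, und A m s = σ := by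
  refine ⟨(TopCat.toSSetObjEquiv (TopCat.of A) (op (SimplexCategory.mk m))).symm
    ⟨fun x => ⟨σ x, hσ.2 x⟩, hσ.1.subtype_mk _⟩, ?_⟩
  rfl

/-- Comparison map. -/
noncomputable def th (A : Set V) (m : ℕ) : (SC A).X m →ₗ[R] S V (m + 1) :=
  (lmapDomain R R (und A m) : (Sing A m →₀ R) →ₗ[R] S V (m + 1))

theorem th_inj (A : Set V) (m : ℕ) : Function.Injective (th A m) :=
  Finsupp.mapDomain_injective (und_inj A m)

theorem th_mem (A : Set V) (m : ℕ) (x : (SC A).X m) : th A m x ∈ Ch A (m + 1) := by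
  have h : ∀ y : Sing A m →₀ R, lmapDomain R R (und A m) y ∈ Ch A (m + 1) := by
    intro y
    induction y using Finsupp.induction_linear with
    | zero => simp
    | add f g hf hg => rw [map_add]; exact add_mem hf hg
    | single a b =>
      rw [lmapDomain_apply, mapDomain_single]
      exact single_mem_supported R _ (und_mem A m a)
  exact h x

theorem th_surj (A : Set V) (m : ℕ) (z) (hz : z ∈ Ch A (m + 1)) : ∃ x, th A m x = z := by
  have := Ch_induction LinearMap.id (LinearMap.range (th A m)) (fun σ hσ => by
    obtain ⟨s, rfl⟩ := und_surj A m σ hσ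
    exact ⟨(single s 1 : Sing A m →₀ R), mapDomain_single⟩) hz
  exact this

theorem th_SCi {A B : Set V} (h : A ⊆ B) (m : ℕ) (x : (SC A).X m) :
    th B m ((SCi h).f m x) = th A m x := by
  have key : ∀ s : Sing A m, th B m ((SCi h).f m (single s 1 : Sing A m →₀ R)) =
      th A m (single s 1 : Sing A m →₀ R) := by
    intro s
    have : (SCi h).f m (single s 1 : Sing A m →₀ R) = (single ((TopCat.toSSet.map
      (TopCat.ofHom ⟨Set.inclusion h, continuous_inclusion h⟩)).app _ s) 1 : Sing B m →₀ R) := by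
      exact mapDomain_single
    rw [this]
    refine (mapDomain_single).trans ?_
    refine Eq.trans ?_ (mapDomain_single).symm
    rfl
  exact lext (X := Sing A m) (f := th B m ∘ₗ ((SCi h).f m).hom) (g := th A m) key x

theorem SC_d (A : Set V) (m : ℕ) (x : (SC A).X (m + 1)) :
    (SC A).d (m + 1) m x = ∑ i : Fin (m + 2), (-1 : ℤ) ^ (i : ℕ) •
      (((((SimplicialObject.whiskering _ _).obj (ModuleCat.free R)).obj
      (TopCat.toSSet.obj (TopCat.of A))).δ i).hom x : (SC A).X m) := by
  have h := AlgebraicTopology.AlternatingFaceMapComplex.obj_d_eq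
    (((SimplicialObject.whiskering _ _).obj (ModuleCat.free R)).obj
      (TopCat.toSSet.obj (TopCat.of A))) m
  have h2 := congrArg (fun f => ModuleCat.Hom.hom f x) h
  refine h2.trans ?_
  simp only [ModuleCat.hom_sum, ModuleCat.hom_zsmul, LinearMap.sum_apply, LinearMap.smul_apply]

theorem th_d (A : Set V) (m : ℕ) (x : (SC A).X (m + 1)) :
    th A m ((SC A).d (m + 1) m x) = sbd (th A (m + 1) x) := by
  have key : ∀ s : Sing A (m + 1), th A m ((SC A).d (m + 1) m (single s 1 : Sing A (m + 1) →₀ R)) =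
      sbd (th A (m + 1) (single s 1 : Sing A (m + 1) →₀ R)) := by
    intro s
    have e1 : th A (m + 1) (single s 1 : Sing A (m + 1) →₀ R) = single (und A (m + 1) s) 1 :=
      mapDomain_single
    rw [e1, sbd_single]
    refine (congrArg (th A m) (SC_d A m (single s 1 : Sing A (m + 1) →₀ R))).trans ?_
    refine (map_sum (th A m) _ _).trans ?_
    refine Finset.sum_congr rfl fun i _ => ?_
    refine (map_zsmul (th A m) _ _).trans ?_
    refine congrArg (fun y => (-1 : ℤ) ^ (i : ℕ) • y) ?_
    have e2 : ((((SimplicialObject.whiskering _ _).obj (ModuleCat.free R)).obj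
        (TopCat.toSSet.obj (TopCat.of A))).δ i).hom (single s 1 : Sing A (m + 1) →₀ R) =
        (single ((TopCat.toSSet.obj (TopCat.of A)).δ i s) 1 : Sing A m →₀ R) := mapDomain_single
    exact (congrArg (th A m) e2).trans mapDomain_single
  exact lext (X := Sing A (m + 1)) (f := th A m ∘ₗ ((SC A).d (m + 1) m).hom)
    (g := sbd ∘ₗ th A (m + 1)) key x

theorem iso_of_Rel {A B : Set V} (h : A ⊆ B) (j : ℕ) (h1 : Rel j A B) (h2 : Rel (j + 1) A B) :
    Nonempty ((SC A).homology j ≅ (SC B).homology j) := by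
  have hinj : ∀ y : (SC A).X j, ∀ w : (SC B).X (j + 1),
      (SCi h).f j y = (SC B).d (j + 1) j w → ∃ u : (SC A).X (j + 1), y = (SC A).d (j + 1) j u := by
    intro y w hw
    have e : sbd (th B (j + 1) w) = th A j y := by rw [← th_d, ← hw, th_SCi]
    obtain ⟨v, hv, hu⟩ := h2 (th B (j + 1) w) (th_mem _ _ _) (e ▸ th_mem _ _ _)
    obtain ⟨u, hu⟩ := th_surj A _ _ hu
    refine ⟨u, th_inj A j ?_⟩
    rw [th_d, hu, map_sub, sbd_sbd, sub_zero, e]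
  have hsur : ∀ z : (SC B).X j, sbd (th B j z) ∈ Ch A j → ∃ y : (SC A).X j,
      ∃ w : (SC B).X (j + 1), z = (SCi h).f j y + (SC B).d (j + 1) j w := by
    intro z hz
    obtain ⟨w, hw, hy⟩ := h1 (th B j z) (th_mem _ _ _) hz
    obtain ⟨y, hy⟩ := th_surj A _ _ hy
    obtain ⟨w, rfl⟩ := th_surj B (j + 1) _ hw
    refine ⟨y, w, th_inj B j ?_⟩
    rw [map_add, th_SCi, th_d, hy, sub_add_cancel]
  cases j with
  | zero =>
    refine iso_of (SCi h) 1 0 0 (by simp) (by simp) (fun z _ => ?_) (fun y _ w hw => hinj y w hw)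
    obtain ⟨y, w, e⟩ := hsur z (by
      refine Ch_induction sbd _ (fun σ hσ => ?_) (th_mem B 0 z)
      rw [sbd_single]
      refine Submodule.sum_mem _ fun i _ => ?_
      refine Submodule.smul_of_tower_mem _ _ (single_mem_Ch ?_)
      refine ⟨hσ.1.comp (stdSimplex.continuous_map _), fun x => ?_⟩
      have := x.2.2
      simp at this)
    refine ⟨y, ?_, w, e⟩
    rw [(SC A).shape 0 0 (by simp)]
    rfl
  | succ j =>
    refine iso_of (SCi h) (j + 2) (j + 1) j (by simp) (by simp) (fun z hz => ?_)
      (fun y _ w hw => hinj y w hw)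
    have hz' : sbd (th B (j + 1) z) = 0 := by rw [← th_d, hz, map_zero]
    obtain ⟨y, w, e⟩ := hsur z (by rw [hz']; exact zero_mem _)
    refine ⟨y, ?_, w, e⟩
    apply th_inj A j
    rw [th_d, map_zero, ← th_SCi h]
    have : (SCi h).f (j + 1) y = z - (SC B).d (j + 2) (j + 1) w := by rw [e]; abel
    rw [this, map_sub, map_sub, hz', th_d, sbd_sbd, sub_zero]

end CubeDel

open CubeFace in
/-- if `S ≅ ∂I^{k+1}` (`k ≥ 2`) is the boundary of a face of a cubical
manifold `M ⊆ I^n` of dimension `d`, then `H_j(|M ∖ S|; ℤ/2) ≅ H_j(|M|; ℤ/2)` for all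
`j ≤ d − 2`. -/
theorem deletion_homology_boundary_case
    {n d k : ℕ} (hk : 2 ≤ k)
    (M : Set (CubeFace n)) (hM : IsSubcomplex M) (hdim : HasDim M d)
    (hman : IsCompactManifold (↥(real M)) d)
    (S : Set (CubeFace n)) (hS : IsSubcomplex S) (hSM : S ⊆ M)
    (hiso : Iso S (boundaryCube (k + 1)))
    (hbd : ∃ F ∈ M, dim F = k + 1 ∧ S = bdryHat F) :
    ∀ j : ℕ, j + 2 ≤ d →
      Nonempty (sHomology (ZMod 2) (↥(real (delete M S))) j ≅
        sHomology (ZMod 2) (↥(real M)) j) := by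
  intro j hj
  obtain ⟨F, hF, hdimF, rfl⟩ := hbd
  have hne : (CubeDel.freeC F).Nonempty := by
    have h0 : 0 < dim F := by omega
    unfold dim at h0
    obtain ⟨i, hi⟩ := Finset.card_pos.1 h0
    exact ⟨i, CubeDel.mem_freeC.2 (by simpa using hi)⟩
  have hsub : real (delete M (bdryHat F)) ⊆ real M :=
    Set.biUnion_subset_biUnion_left fun G hG => hG.1
  exact CubeDel.iso_of_Rel hsub j
    (CubeDel.main_rel hM hman.2 hF hne j (by omega))
    (CubeDel.main_rel hM hman.2 hF hne (j + 1) (by omega))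
end
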